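/- Let $(X,\sigma_X)$, $(Y,\sigma_Y)$ be one-sided subshifts, $\pi: X \to Y$ a one-block factor map, and $f \in C(X)$. Then for every $\phi \in C(Y)$: $\sup_{\mu\in M(X,\sigma_X)}\{h_\mu(\sigma_X) - \int P(\sigma_X,\pi,f)\circ\pi\, d\mu + \int f\,d\mu + \int \phi\circ\pi\, d\mu\} = \sup_{\nu\in M(Y,\sigma_Y)}\{h_\nu(\sigma_Y) + \int\phi\,d\nu\}$; that is, $f - P(\sigma_X,\pi,f)\circ\pi$ is a Borel-measurable compensation function for $\pi$. -/

import Mathlib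

open Filter Topology MeasureTheory

/-- The shift map on the full one-sided shift on `k` symbols. -/
def shiftMap {k : ℕ} : (ℕ → Fin k) → (ℕ → Fin k) := fun x n => x (n + 1)

/-- A one-sided subshift: a closed, shift-invariant subset of the full shift. -/
def IsSubshift {k : ℕ} (X : Set (ℕ → Fin k)) : Prop :=
  IsClosed X ∧ ∀ x ∈ X, shiftMap x ∈ X

/-- Birkhoff sum `S_n h = ∑_{i<n} h ∘ T^i`. -/
noncomputable def birk {α : Type*} (T : α → α) (h : α → ℝ) (n : ℕ) (x : α) : ℝ :=
  ∑ i ∈ Finset.range n, h (T^[i] x)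

/-- The word `u` of length `n` appears in (is allowable for) the subshift `X`. -/
def WordIn {k : ℕ} (X : Set (ℕ → Fin k)) {n : ℕ} (u : Fin n → Fin k) : Prop :=
  ∃ x ∈ X, ∀ i : Fin n, x (i : ℕ) = u i

/-- The cylinder set of the word `u` inside the subshift `X`. -/
def cylSet {k : ℕ} (X : Set (ℕ → Fin k)) {n : ℕ} (u : Fin n → Fin k) : Set X :=
  {x : X | ∀ i : Fin n, (x : ℕ → Fin k) (i : ℕ) = u i}

/-- The periodic sequence `(u)^∞` obtained by repeating the word `u`. -/
def periodize {k p : ℕ} (hp : 0 < p) (u : Fin p → Fin k) : ℕ → Fin k :=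
  fun i => u ⟨i % p, Nat.mod_lt i hp⟩

/-- A sequence `{log f_n}` is asymptotically additive on the subshift `X` (with shift `σ`)
if for every `ε > 0` there is a continuous `ρ` with
`limsup_n (1/n)‖log f_n - S_n ρ‖_∞ < ε`. -/
def AsympAdd {k : ℕ} (X : Set (ℕ → Fin k)) (σ : X → X) (f : ℕ → X → ℝ) : Prop :=
  ∀ ε : ℝ, 0 < ε → ∃ ρ : X → ℝ, Continuous ρ ∧
    Filter.limsup
      (fun n : ℕ => (1 / (n : ℝ)) * ⨆ x : X, |Real.log (f n x) - birk σ ρ n x|)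
      Filter.atTop < ε

/-- Measure-theoretic entropy of a measure on a one-sided subshift, computed with the
canonical generating partition into cylinders. -/
noncomputable def mEntropy {k : ℕ} (X : Set (ℕ → Fin k)) (μ : MeasureTheory.Measure X) : ℝ :=
  Filter.liminf
    (fun n : ℕ => (1 / (n : ℝ)) *
      ∑ u : Fin n → Fin k, Real.negMulLog ((μ (cylSet X u)).toReal))
    Filter.atTop

-- The standard metric on the full shift: `d(x,y) = (1/2)^{min{i : x_i ≠ y_i}}`.
open Classical in
noncomputable def dSeq {k : ℕ} (x y : ℕ → Fin k) : ℝ :=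
  if x = y then 0 else (1 / 2 : ℝ) ^ (sInf {i : ℕ | x i ≠ y i})

/-- `P_n(σ, π, f, δ)(y)`: supremum of `∑_{x ∈ E} e^{S_n f(x)}` over `(n,δ)`-separated
subsets `E` of the fiber `π⁻¹(y)`. -/
noncomputable def relPn {k l : ℕ} (X : Set (ℕ → Fin k)) (σ : X → X)
    (πs : X → (ℕ → Fin l)) (f : X → ℝ) (n : ℕ) (δ : ℝ) (y : ℕ → Fin l) : ℝ :=
  sSup {s : ℝ | ∃ E : Finset X, (∀ x ∈ E, πs x = y) ∧
    (∀ x ∈ E, ∀ x' ∈ E, x ≠ x' →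
      ∃ i < n, δ ≤ dSeq ((σ^[i] x : X) : ℕ → Fin k) ((σ^[i] x' : X) : ℕ → Fin k)) ∧
    s = ∑ x ∈ E, Real.exp (birk σ f n x)}

/-- The relative pressure function `P(σ, π, f) : (ℕ → Fin l) → ℝ` of `f`. -/
noncomputable def relP {k l : ℕ} (X : Set (ℕ → Fin k)) (σ : X → X)
    (πs : X → (ℕ → Fin l)) (f : X → ℝ) (y : ℕ → Fin l) : ℝ :=
  ⨆ δ : {δ : ℝ // 0 < δ},
    Filter.limsup (fun n : ℕ => (1 / (n : ℝ)) * Real.log (relPn X σ πs f n δ.1 y))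
      Filter.atTop

/-- `g_n(y) = sup_{E_n(y)} ∑_{x ∈ E_n(y)} e^{S_n f(x)}`, where `E_n(y)` consists of exactly
one point from each cylinder `[x_1…x_n]` of `X` whose word is mapped by the one-block map
to `y_1…y_n`. -/
noncomputable def gfun {k l : ℕ} (X : Set (ℕ → Fin k)) (σ : X → X)
    (πs : X → (ℕ → Fin l)) (f : X → ℝ) (n : ℕ) (y : ℕ → Fin l) : ℝ :=
  sSup {s : ℝ | ∃ E : Finset X,
    (∀ x ∈ E, ∀ i : Fin n, πs x (i : ℕ) = y (i : ℕ)) ∧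
    (∀ x ∈ E, ∀ x' ∈ E, (∀ i : Fin n, (x : ℕ → Fin k) (i : ℕ) = (x' : ℕ → Fin k) (i : ℕ)) →
      x = x') ∧
    (∀ u : Fin n → Fin k,
      (∃ z : X, (∀ i : Fin n, (z : ℕ → Fin k) (i : ℕ) = u i) ∧
        ∀ i : Fin n, πs z (i : ℕ) = y (i : ℕ)) →
      ∃ x ∈ E, ∀ i : Fin n, (x : ℕ → Fin k) (i : ℕ) = u i) ∧
    s = ∑ x ∈ E, Real.exp (birk σ f n x)}


/-! ### Bounded sequences and limsup -/

lemma bdd_above_of {u : ℕ → ℝ} {C : ℝ} (h : ∀ n, |u n| ≤ C) :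
    IsBoundedUnder (· ≤ ·) atTop u :=
  isBoundedUnder_of ⟨C, fun n => (abs_le.1 (h n)).2⟩

lemma bdd_below_of {u : ℕ → ℝ} {C : ℝ} (h : ∀ n, |u n| ≤ C) :
    IsBoundedUnder (· ≥ ·) atTop u :=
  isBoundedUnder_of ⟨-C, fun n => (abs_le.1 (h n)).1⟩

lemma cobdd_of {u : ℕ → ℝ} {C : ℝ} (h : ∀ n, |u n| ≤ C) :
    IsCoboundedUnder (· ≤ ·) atTop u :=
  (bdd_below_of h).isCoboundedUnder_le

lemma limsup_abs_le {u : ℕ → ℝ} {C : ℝ} (h : ∀ n, |u n| ≤ C) :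
    |limsup u atTop| ≤ C := by
  rw [abs_le]
  constructor
  · exact le_limsup_of_frequently_le (Frequently.of_forall fun n => (abs_le.1 (h n)).1)
      (bdd_above_of h)
  · exact limsup_le_of_le (cobdd_of h) (Eventually.of_forall fun n => (abs_le.1 (h n)).2)

lemma limsup_le_limsup_add {u v e : ℕ → ℝ} {C D : ℝ} (hu : ∀ n, |u n| ≤ C)
    (hv : ∀ n, |v n| ≤ D)
    (he : Tendsto e atTop (𝓝 0)) (h : ∀ᶠ n in atTop, v n ≤ u n + e n) :
    limsup v atTop ≤ limsup u atTop := by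
  refine le_of_forall_pos_le_add fun ε hε => ?_
  refine limsup_le_of_le (cobdd_of hv) ?_
  have h1 := eventually_lt_of_limsup_lt (f := atTop) (u := u) (b := limsup u atTop + ε / 2)
    (by linarith) (bdd_above_of hu)
  have h2 : ∀ᶠ n in atTop, e n < ε / 2 := he.eventually_lt_const (by linarith)
  filter_upwards [h, h1, h2] with n a b c
  linarith

/-- Reverse Fatou for uniformly bounded functions. -/
lemma reverse_fatou {Ω : Type*} [MeasurableSpace Ω] (ν : Measure Ω) [IsProbabilityMeasure ν]
    (a : ℕ → Ω → ℝ) (ha : ∀ n, Measurable (a n)) (C : ℝ) (hC : ∀ n x, |a n x| ≤ C)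
    (c : ℝ) (hc : ∀ n, 1 ≤ n → c ≤ ∫ x, a n x ∂ν) :
    c ≤ ∫ x, limsup (fun n => a n x) atTop ∂ν := by
  set S : ℕ → Ω → ℝ := fun N x => ⨆ n : ℕ, a (n + N) x with hS
  have hbdd : ∀ N x, BddAbove (Set.range fun n : ℕ => a (n + N) x) := by
    intro N x
    refine ⟨C, ?_⟩
    rintro _ ⟨n, rfl⟩
    exact (abs_le.1 (hC _ _)).2
  have hSa : ∀ N n x, a (n + N) x ≤ S N x := fun N n x => le_ciSup (hbdd N x) n
  have hSC : ∀ N x, |S N x| ≤ C := by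
    intro N x
    rw [abs_le]
    refine ⟨(abs_le.1 (hC (0 + N) x)).1.trans (hSa N 0 x), ciSup_le fun n => (abs_le.1 (hC _ _)).2⟩
  have hSm : ∀ N, Measurable (S N) := fun N => Measurable.iSup fun n => ha _
  have hlim : ∀ x, Tendsto (fun N => S N x) atTop (𝓝 (limsup (fun n => a n x) atTop)) := by
    intro x
    rw [Metric.tendsto_atTop]
    intro ε hε
    have h1 := eventually_lt_of_limsup_lt (f := atTop) (u := fun n => a n x)
      (b := limsup (fun n => a n x) atTop + ε / 2) (by linarith) (bdd_above_of (hC · x))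
    obtain ⟨N0, hN0⟩ := eventually_atTop.1 h1
    refine ⟨N0, fun N hN => ?_⟩
    have hle : S N x ≤ limsup (fun n => a n x) atTop + ε / 2 :=
      ciSup_le fun n => (hN0 (n + N) (by omega)).le
    have hge : limsup (fun n => a n x) atTop ≤ S N x := by
      refine limsup_le_of_le (cobdd_of (hC · x)) ?_
      filter_upwards [eventually_ge_atTop N] with n hn
      have := hSa N (n - N) x
      rwa [Nat.sub_add_cancel hn] at this
    rw [Real.dist_eq, abs_lt]
    constructor <;> linarith
  have hT : Tendsto (fun N => ∫ x, S N x ∂ν) atTop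
      (𝓝 (∫ x, limsup (fun n => a n x) atTop ∂ν)) :=
    tendsto_integral_of_dominated_convergence (fun _ => C)
      (fun N => (hSm N).aestronglyMeasurable) (integrable_const _)
      (fun N => Eventually.of_forall fun x => by simpa using hSC N x)
      (Eventually.of_forall hlim)
  refine ge_of_tendsto hT ?_
  filter_upwards [eventually_ge_atTop 1] with N hN
  refine (hc N hN).trans (integral_mono ?_ ?_ fun x => ?_)
  · exact Integrable.of_bound (ha N).aestronglyMeasurable C
      (Eventually.of_forall fun x => by simpa using hC N x)
  · exact Integrable.of_bound (hSm N).aestronglyMeasurable C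
      (Eventually.of_forall fun x => by simpa using hSC N x)
  · simpa using hSa N 0 x

/-! ### Birkhoff sums -/

lemma birk_succ' {α : Type*} (T : α → α) (h : α → ℝ) (n : ℕ) (x : α) :
    birk T h (n + 1) x = h x + birk T h n (T x) := by
  unfold birk
  rw [Finset.sum_range_succ']
  simp [Function.iterate_succ_apply, add_comm]

lemma birk_add {α : Type*} (T : α → α) (h : α → ℝ) (m n : ℕ) (x : α) :
    birk T h (m + n) x = birk T h m x + birk T h n (T^[m] x) := by
  unfold birk
  rw [Finset.sum_range_add]
  congr 1
  refine Finset.sum_congr rfl fun i _ => ?_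
  rw [← Function.iterate_add_apply, add_comm]

lemma birk_abs_le {α : Type*} (T : α → α) (h : α → ℝ) (C : ℝ) (hC : ∀ x, |h x| ≤ C) (n : ℕ)
    (x : α) : |birk T h n x| ≤ n * C := by
  unfold birk
  refine (Finset.abs_sum_le_sum_abs _ _).trans ?_
  refine (Finset.sum_le_sum fun i _ => hC _).trans ?_
  simp

lemma birk_measurable {α : Type*} [MeasurableSpace α] {T : α → α} (hT : Measurable T)
    {h : α → ℝ} (hh : Measurable h) (n : ℕ) : Measurable (birk T h n) := by
  unfold birk
  exact Finset.measurable_sum _ fun i _ => hh.comp (hT.iterate i)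

lemma birk_integral {α : Type*} [MeasurableSpace α] {ν : Measure α} [IsProbabilityMeasure ν]
    {T : α → α} (hT : MeasurePreserving T ν ν) {h : α → ℝ} (hh : Measurable h)
    (hi : Integrable h ν) (n : ℕ) :
    ∫ x, birk T h n x ∂ν = n * ∫ x, h x ∂ν := by
  unfold birk
  have key : ∀ i, ∫ x, h (T^[i] x) ∂ν = ∫ x, h x ∂ν := by
    intro i
    have h1 := (hT.iterate i)
    rw [← integral_map (φ := T^[i]) h1.measurable.aemeasurable hh.aestronglyMeasurable, h1.map_eq]
  rw [integral_finsetSum]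
  · simp [key]
  · intro i _
    exact (hT.iterate i).integrable_comp_of_integrable hi

lemma avg_abs_le {a C : ℝ} {n : ℕ} (h : |a| ≤ n * C) (hC : 0 ≤ C) : |(1 / (n : ℝ)) * a| ≤ C := by
  rcases Nat.eq_zero_or_pos n with rfl | hn
  · simpa using hC
  · have : (0 : ℝ) < n := by exact_mod_cast hn
    rw [abs_mul, abs_of_pos (by positivity : (0 : ℝ) < 1 / n)]
    rw [div_mul_eq_mul_div, one_mul, div_le_iff₀ this]
    linarith

/-- The integral of the limsup of Birkhoff averages is at most the integral (one half of
Birkhoff's theorem). -/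
lemma birkhoff_limsup {Ω : Type*} [MeasurableSpace Ω] (ν : Measure Ω) [IsProbabilityMeasure ν]
    (T : Ω → Ω) (hT : MeasurePreserving T ν ν) (h : Ω → ℝ) (hh : Measurable h) (C : ℝ)
    (hC : ∀ x, |h x| ≤ C) :
    ∫ x, limsup (fun n : ℕ => (1 / (n : ℝ)) * birk T h n x) atTop ∂ν ≤ ∫ x, h x ∂ν := by
  obtain ⟨x0⟩ : Nonempty Ω := nonempty_of_isProbabilityMeasure ν
  have hC0 : 0 ≤ C := (abs_nonneg _).trans (hC x0)
  set s : Ω → ℝ := fun x => limsup (fun n : ℕ => (1 / (n : ℝ)) * birk T h n x) atTop with hs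
  have hab : ∀ x (n : ℕ), |(1 / (n : ℝ)) * birk T h n x| ≤ C :=
    fun x n => avg_abs_le (birk_abs_le T h C hC n x) hC0
  have hsC : ∀ x, |s x| ≤ C := fun x => limsup_abs_le (hab x)
  have hsm : Measurable s := by
    refine Measurable.limsup fun n => ?_
    exact (birk_measurable hT.measurable hh n).const_mul _
  have hsi : Integrable s ν := Integrable.of_bound hsm.aestronglyMeasurable C
      (Eventually.of_forall fun x => by simpa using hsC x)
  have hhi : Integrable h ν := Integrable.of_bound hh.aestronglyMeasurable C
      (Eventually.of_forall fun x => by simpa using hC x)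
  have hinv : ∀ x, s x ≤ s (T x) := by
    intro x
    refine limsup_le_limsup_add (e := fun n : ℕ => 2 * C / n) (hab (T x)) (hab x)
      (tendsto_const_div_atTop_nhds_zero_nat _) ?_
    filter_upwards [eventually_gt_atTop 0] with n hn
    have hn' : (0 : ℝ) < n := by exact_mod_cast hn
    have e1 := birk_succ' T h n x
    have e2 : birk T h (n + 1) x = birk T h n x + h (T^[n] x) := by
      unfold birk; rw [Finset.sum_range_succ]
    have h1 := abs_le.1 (hC x)
    have h2 := abs_le.1 (hC (T^[n] x))
    have : birk T h n x ≤ birk T h n (T x) + 2 * C := by linarith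
    rw [div_mul_eq_mul_div, div_mul_eq_mul_div, ← add_div]
    gcongr
    linarith
  have hinv' : ∀ n x, s x ≤ s (T^[n] x) := by
    intro n
    induction n with
    | zero => intro x; simp
    | succ n ih => intro x; rw [Function.iterate_succ_apply]; exact (hinv x).trans (ih _)
  refine le_of_forall_pos_le_add fun ε hε => ?_
  set B : ℕ → Set Ω := fun M => {x | ∀ n, 1 ≤ n → n ≤ M → birk T h n x < n * (s x - ε)} with hB
  have hBm : ∀ M, MeasurableSet (B M) := by
    intro M
    have : B M = ⋂ n : ℕ, {x | 1 ≤ n → n ≤ M → birk T h n x < n * (s x - ε)} := by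
      ext x; simp [hB]
    rw [this]
    refine MeasurableSet.iInter fun n => ?_
    by_cases h1 : 1 ≤ n <;> by_cases h2 : n ≤ M <;> simp only [h1, h2, true_imp_iff, false_imp_iff,
      Set.ofPred_true, MeasurableSet.univ, implies_true]
    exact measurableSet_lt (birk_measurable hT.measurable hh n) ((hsm.sub_const ε).const_mul _)
  have hBanti : Antitone B := by
    intro M M' hMM' x hx n h1 h2
    exact hx n h1 (h2.trans hMM')
  have hBempty : ⋂ M, B M = ∅ := by
    rw [Set.eq_empty_iff_forall_notMem]
    intro x hx
    have h1 : ∃ᶠ n : ℕ in atTop, s x - ε < (1 / (n : ℝ)) * birk T h n x :=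
      frequently_lt_of_lt_limsup (cobdd_of (hab x)) (by change s x - ε < s x; linarith)
    obtain ⟨n, hn, hn1⟩ := (h1.and_eventually (eventually_ge_atTop 1)).exists
    have h2 := Set.mem_iInter.1 hx n n hn1 le_rfl
    have hn' : (0 : ℝ) < n := by exact_mod_cast hn1
    rw [div_mul_eq_mul_div, one_mul, lt_div_iff₀ hn'] at hn
    linarith
  have hBlim : Tendsto (fun M => ν.real (B M)) atTop (𝓝 0) := by
    have := tendsto_measure_iInter_atTop (μ := ν) (fun i => (hBm i).nullMeasurableSet) hBanti
      ⟨0, measure_ne_top _ _⟩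
    rw [hBempty, measure_empty] at this
    have h2 := (ENNReal.tendsto_toReal ENNReal.zero_ne_top).comp this
    simpa [Measure.real, Function.comp_def] using h2
  have main : ∀ M, 1 ≤ M → ∫ x, s x ∂ν - ε ≤ ∫ x, h x ∂ν + 2 * C * ν.real (B M) := by
    intro M hM
    set g : Ω → ℝ := fun x => h x + (B M).indicator (fun _ => 2 * C) x with hg
    have hindi : Integrable ((B M).indicator fun _ => 2 * C) ν :=
      (integrable_const _).indicator (hBm M)
    have hgm : Measurable g := hh.add (measurable_const.indicator (hBm M))
    have hgi : Integrable g ν := hhi.add hindi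
    have hgint : ∫ x, g x ∂ν = ∫ x, h x ∂ν + 2 * C * ν.real (B M) := by
      rw [hg, integral_add hhi hindi, integral_indicator_const _ (hBm M), smul_eq_mul, mul_comm]
    have hgh : ∀ x, h x ≤ g x := by
      intro x
      have : 0 ≤ (B M).indicator (fun _ => 2 * C) x := Set.indicator_nonneg (fun _ _ => by linarith) x
      simp only [hg]; linarith
    have hstep : ∀ x, ∃ n, 1 ≤ n ∧ n ≤ M ∧ n * (s x - ε) ≤ birk T g n x := by
      intro x
      by_cases hx : x ∈ B M
      · refine ⟨1, le_rfl, hM, ?_⟩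
        have h1 := abs_le.1 (hC x)
        have h2 := abs_le.1 (hsC x)
        simp only [birk, hg, Finset.range_one, Finset.sum_singleton, Function.iterate_zero, id,
          Set.indicator_of_mem hx]
        push_cast
        linarith
      · simp only [hB, Set.mem_ofPred_eq, not_forall, not_lt] at hx
        obtain ⟨n, h1, h2, h3⟩ := hx
        refine ⟨n, h1, h2, h3.trans ?_⟩
        exact Finset.sum_le_sum fun i _ => hgh _
    have hind : ∀ L x, L * (s x - ε) - M * (2 * C) ≤ birk T g L x := by
      intro L
      induction L using Nat.strong_induction_on with
      | _ L ih =>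
        intro x
        by_cases hL : L ≤ M
        · have h1 : -(L * C) ≤ birk T g L x := by
            have := (abs_le.1 (birk_abs_le T h C hC L x)).1
            exact this.trans (Finset.sum_le_sum fun i _ => hgh _)
          have h2 := abs_le.1 (hsC x)
          have hL' : (L : ℝ) ≤ M := by exact_mod_cast hL
          have h3 : (L : ℝ) * (s x - ε) ≤ L * C := by
            gcongr; linarith
          have h4 : (L : ℝ) * C ≤ M * C := by gcongr
          linarith
        · obtain ⟨n, h1, h2, h3⟩ := hstep x
          have h4 := ih (L - n) (by omega) (T^[n] x)
          have h5 := birk_add T g n (L - n) x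
          rw [Nat.add_sub_cancel' (by omega)] at h5
          rw [h5]
          have h6 : ((L - n : ℕ) : ℝ) = L - n := by
            rw [Nat.cast_sub (by omega)]
          have h7 : ((L - n : ℕ) : ℝ) * (s x - ε) ≤ ((L - n : ℕ) : ℝ) * (s (T^[n] x) - ε) := by
            gcongr
            exact hinv' n x
          rw [h6] at h7 h4
          linarith
    have hLint : ∀ L : ℕ, 0 < L → ∫ x, s x ∂ν - ε - M * (2 * C) / L ≤ ∫ x, g x ∂ν := by
      intro L hL
      have hL' : (0 : ℝ) < L := by exact_mod_cast hL
      have h1 : ∫ x, (L * (s x - ε) - M * (2 * C)) ∂ν ≤ ∫ x, birk T g L x ∂ν := by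
        refine integral_mono (((hsi.sub (integrable_const _)).const_mul _).sub (integrable_const _))
          ?_ (hind L)
        unfold birk
        refine integrable_finsetSum _ fun i _ => ?_
        exact (hT.iterate i).integrable_comp_of_integrable hgi
      have hse : Integrable (fun x => s x - ε) ν := hsi.sub (integrable_const _)
      rw [birk_integral hT hgm hgi, integral_sub (hse.const_mul _)
        (integrable_const _), integral_const_mul, integral_sub hsi (integrable_const _)] at h1
      simp only [integral_const, probReal_univ, one_smul] at h1
      rw [sub_le_iff_le_add, ← sub_le_iff_le_add', le_div_iff₀ hL']
      linarith
    rw [← hgint]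
    have hlim : Tendsto (fun L : ℕ => ∫ x, s x ∂ν - ε - M * (2 * C) / L) atTop
        (𝓝 (∫ x, s x ∂ν - ε - 0)) :=
      tendsto_const_nhds.sub (tendsto_const_div_atTop_nhds_zero_nat _)
    rw [sub_zero] at hlim
    refine le_of_tendsto hlim ?_
    filter_upwards [eventually_gt_atTop 0] with L hL using hLint L hL
  have hfin : Tendsto (fun M => ∫ x, h x ∂ν + 2 * C * ν.real (B M)) atTop
      (𝓝 (∫ x, h x ∂ν + 2 * C * 0)) := tendsto_const_nhds.add (hBlim.const_mul _)
  have := ge_of_tendsto hfin (by filter_upwards [eventually_ge_atTop 1] with M hM using main M hM)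
  linarith

/-! ### Finite entropy -/

/-- Shannon entropy of a finite-valued random variable. -/
noncomputable def ent {Ω α : Type*} [MeasurableSpace Ω] [Fintype α] (μ : Measure Ω)
    (A : Ω → α) : ℝ :=
  ∑ a, Real.negMulLog (μ.real (A ⁻¹' {a}))

set_option linter.unusedSectionVars false

section Entropy

variable {Ω α β : Type*} [MeasurableSpace Ω] [Fintype α] [Fintype β]
  [MeasurableSpace α] [MeasurableSingletonClass α] [MeasurableSpace β] [MeasurableSingletonClass β]

lemma integrable_fin (μ : Measure Ω) [IsProbabilityMeasure μ] {A : Ω → α} (hA : Measurable A)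
    (φ : α → ℝ) : Integrable (fun x => φ (A x)) μ := by
  have : IsProbabilityMeasure (μ.map A) := Measure.isProbabilityMeasure_map hA.aemeasurable
  have h : Integrable φ (μ.map A) := Integrable.of_finite
  exact h.comp_measurable hA

lemma integral_fin (μ : Measure Ω) [IsProbabilityMeasure μ] {A : Ω → α} (hA : Measurable A)
    (φ : α → ℝ) : ∫ x, φ (A x) ∂μ = ∑ a, μ.real (A ⁻¹' {a}) * φ a := by
  have : IsProbabilityMeasure (μ.map A) := Measure.isProbabilityMeasure_map hA.aemeasurable
  have h : Integrable φ (μ.map A) := Integrable.of_finite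
  rw [← integral_map hA.aemeasurable h.aestronglyMeasurable, integral_fintype h]
  refine Finset.sum_congr rfl fun a _ => ?_
  rw [map_measureReal_apply hA (measurableSet_singleton a), smul_eq_mul]

lemma sum_law (μ : Measure Ω) [IsProbabilityMeasure μ] {A : Ω → α} (hA : Measurable A) :
    ∑ a, μ.real (A ⁻¹' {a}) = 1 := by
  have := integral_fin μ hA (fun _ => 1)
  simpa using this.symm

lemma ent_eq_integral (μ : Measure Ω) [IsProbabilityMeasure μ] {A : Ω → α} (hA : Measurable A) :
    ent μ A = - ∫ x, Real.log (μ.real (A ⁻¹' {A x})) ∂μ := by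
  rw [integral_fin μ hA (fun a => Real.log (μ.real (A ⁻¹' {a}))), ← Finset.sum_neg_distrib]
  refine Finset.sum_congr rfl fun a _ => ?_
  rw [Real.negMulLog, neg_mul]

/-- Gibbs' inequality. -/
lemma gibbs (μ : Measure Ω) [IsProbabilityMeasure μ] {A : Ω → α} (hA : Measurable A)
    (q : α → ℝ) (hq0 : ∀ a, 0 ≤ q a) (hq1 : ∑ a, q a ≤ 1)
    (hpos : ∀ a, μ.real (A ⁻¹' {a}) ≠ 0 → 0 < q a) :
    ent μ A ≤ - ∫ x, Real.log (q (A x)) ∂μ := by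
  rw [integral_fin μ hA (fun a => Real.log (q a)), ← Finset.sum_neg_distrib, ent]
  have key : ∀ a, Real.negMulLog (μ.real (A ⁻¹' {a})) ≤
      -(μ.real (A ⁻¹' {a}) * Real.log (q a)) + (q a - μ.real (A ⁻¹' {a})) := by
    intro a
    set p := μ.real (A ⁻¹' {a}) with hp
    by_cases h0 : p = 0
    · rw [h0]; simp [hq0 a]
    · have hp0 : 0 < p := lt_of_le_of_ne measureReal_nonneg (Ne.symm h0)
      have hqa := hpos a h0
      have h1 := Real.log_le_sub_one_of_pos (div_pos hqa hp0)
      rw [Real.log_div hqa.ne' hp0.ne'] at h1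
      have h2 := mul_le_mul_of_nonneg_left h1 hp0.le
      have h3 : p * (q a / p - 1) = q a - p := by field_simp
      rw [Real.negMulLog]
      rw [h3] at h2
      linarith
  refine (Finset.sum_le_sum fun a _ => key a).trans ?_
  rw [Finset.sum_add_distrib, Finset.sum_sub_distrib, sum_law μ hA]
  linarith

lemma ent_nonneg (μ : Measure Ω) [IsProbabilityMeasure μ] (A : Ω → α) : 0 ≤ ent μ A :=
  Finset.sum_nonneg fun _ _ => Real.negMulLog_nonneg measureReal_nonneg measureReal_le_one

lemma ent_le_log_card (μ : Measure Ω) [IsProbabilityMeasure μ] {A : Ω → α} (hA : Measurable A) :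
    ent μ A ≤ Real.log (Fintype.card α) := by
  obtain ⟨x0⟩ : Nonempty Ω := nonempty_of_isProbabilityMeasure μ
  have : Nonempty α := ⟨A x0⟩
  have hc : (0 : ℝ) < Fintype.card α := by exact_mod_cast Fintype.card_pos
  have := gibbs μ hA (fun _ => (Fintype.card α : ℝ)⁻¹) (fun _ => by positivity)
    (by simp [hc.ne']) (fun _ _ => by positivity)
  simpa using this

lemma real_preimage_mono_pos (μ : Measure Ω) [IsProbabilityMeasure μ] {s t : Set Ω} (h : s ⊆ t)
    (hs : μ.real s ≠ 0) : 0 < μ.real t :=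
  (lt_of_le_of_ne measureReal_nonneg (Ne.symm hs)).trans_le (measureReal_mono h)

lemma ent_pair_le (μ : Measure Ω) [IsProbabilityMeasure μ] {A : Ω → α} {B : Ω → β}
    (hA : Measurable A) (hB : Measurable B) :
    ent μ (fun x => (A x, B x)) ≤ ent μ A + ent μ B := by
  have hAB : Measurable (fun x => (A x, B x)) := hA.prodMk hB
  have hpos : ∀ a : α × β, μ.real ((fun x => (A x, B x)) ⁻¹' {a}) ≠ 0 →
      0 < μ.real (A ⁻¹' {a.1}) ∧ 0 < μ.real (B ⁻¹' {a.2}) := by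
    intro a ha
    constructor
    · refine real_preimage_mono_pos μ ?_ ha
      rintro x rfl; simp
    · refine real_preimage_mono_pos μ ?_ ha
      rintro x rfl; simp
  have h := gibbs μ hAB (fun a => μ.real (A ⁻¹' {a.1}) * μ.real (B ⁻¹' {a.2}))
    (fun a => mul_nonneg measureReal_nonneg measureReal_nonneg)
    (by rw [Fintype.sum_prod_type]; simp_rw [← Finset.mul_sum, sum_law μ hB, mul_one, sum_law μ hA]
        exact le_rfl)
    (fun a ha => mul_pos (hpos a ha).1 (hpos a ha).2)
  refine h.trans (le_of_eq ?_)
  rw [ent_eq_integral μ hA, ent_eq_integral μ hB, ← neg_add]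
  congr 1
  rw [← integral_add (integrable_fin μ hA (fun a => Real.log (μ.real (A ⁻¹' {a}))))
    (integrable_fin μ hB (fun a => Real.log (μ.real (B ⁻¹' {a}))))]
  have e1 := integral_fin μ hAB (fun a => Real.log (μ.real (A ⁻¹' {a.1}) * μ.real (B ⁻¹' {a.2})))
  have e2 := integral_fin μ hAB
    (fun a => Real.log (μ.real (A ⁻¹' {a.1})) + Real.log (μ.real (B ⁻¹' {a.2})))
  refine e1.trans (Eq.trans ?_ e2.symm)
  refine Finset.sum_congr rfl fun a _ => ?_
  by_cases ha : μ.real ((fun x => (A x, B x)) ⁻¹' {a}) = 0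
  · simp [ha]
  · rw [Real.log_mul (hpos a ha).1.ne' (hpos a ha).2.ne']

lemma law_comp (μ : Measure Ω) [IsProbabilityMeasure μ] {A : Ω → α} (hA : Measurable A)
    [DecidableEq β] (g : α → β) (b : β) :
    μ.real ((fun x => g (A x)) ⁻¹' {b}) = ∑ a with g a = b, μ.real (A ⁻¹' {a}) := by
  rw [← measureReal_biUnion_finset]
  · congr 1
    ext x
    simp
  · intro a _ a' _ h
    refine Set.disjoint_left.2 ?_
    rintro x rfl h'
    exact h h'
  · intro a _
    exact hA (measurableSet_singleton a)

lemma ent_comp_le (μ : Measure Ω) [IsProbabilityMeasure μ] {A : Ω → α} (hA : Measurable A)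
    (g : α → β) : ent μ (fun x => g (A x)) ≤ ent μ A := by
  classical
  have hgA : Measurable (fun x => g (A x)) := (measurable_of_finite g).comp hA
  rw [ent_eq_integral μ hA, ent_eq_integral μ hgA, neg_le_neg_iff]
  rw [integral_fin μ hA (fun a => Real.log (μ.real (A ⁻¹' {a}))),
    integral_fin μ hA (fun a => Real.log (μ.real ((fun x => g (A x)) ⁻¹' {g a})))]
  refine Finset.sum_le_sum fun a _ => ?_
  by_cases ha : μ.real (A ⁻¹' {a}) = 0
  · simp [ha]
  · refine mul_le_mul_of_nonneg_left ?_ measureReal_nonneg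
    refine Real.log_le_log (lt_of_le_of_ne measureReal_nonneg (Ne.symm ha)) (measureReal_mono ?_)
    rintro x rfl; simp

lemma ent_comp_inj (μ : Measure Ω) [IsProbabilityMeasure μ] {A : Ω → α} (hA : Measurable A)
    (g : α → β) (hg : Function.Injective g) : ent μ (fun x => g (A x)) = ent μ A := by
  obtain ⟨x0⟩ : Nonempty Ω := nonempty_of_isProbabilityMeasure μ
  have : Nonempty α := ⟨A x0⟩
  refine le_antisymm (ent_comp_le μ hA g) ?_
  have hgA : Measurable (fun x => g (A x)) := (measurable_of_finite g).comp hA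
  have := ent_comp_le μ hgA (Function.invFun g)
  simpa [Function.leftInverse_invFun hg _] using this

lemma ent_map {Ω' : Type*} [MeasurableSpace Ω'] (μ : Measure Ω) {S : Ω → Ω'} (hS : Measurable S)
    {A : Ω' → α} (hA : Measurable A) : ent (μ.map S) A = ent μ (fun x => A (S x)) := by
  refine Finset.sum_congr rfl fun a _ => ?_
  rw [map_measureReal_apply hS (hA (measurableSet_singleton a))]
  rfl

end Entropy

/-! ### Averaged measures -/

/-- The average of the first `n` push-forwards of a measure. -/
noncomputable def avgM {Ω : Type*} [MeasurableSpace Ω] (T : Ω → Ω) (lam : Measure Ω) (n : ℕ) :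
    Measure Ω :=
  (n : ENNReal)⁻¹ • ∑ i ∈ Finset.range n, lam.map (T^[i])

section Avg

variable {Ω : Type*} [MeasurableSpace Ω] {T : Ω → Ω}

lemma avgM_prob (hT : Measurable T) (lam : Measure Ω) [IsProbabilityMeasure lam] {n : ℕ} (hn : 1 ≤ n) : IsProbabilityMeasure (avgM T lam n) := by
  constructor
  have h1 : ∀ i, (lam.map (T^[i])) Set.univ = 1 := by
    intro i
    rw [Measure.map_apply (hT.iterate i) MeasurableSet.univ]
    simp
  simp only [avgM, Measure.smul_apply, Measure.finsetSum_apply, h1, smul_eq_mul]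
  simp only [Finset.sum_const, Finset.card_range, nsmul_eq_mul, mul_one]
  refine ENNReal.inv_mul_cancel ?_ (ENNReal.natCast_ne_top n)
  exact_mod_cast (by omega : n ≠ 0)

lemma avgM_real (hT : Measurable T) (lam : Measure Ω) [IsProbabilityMeasure lam] {n : ℕ} (s : Set Ω) (hs : MeasurableSet s) :
    (avgM T lam n).real s = (1 / (n : ℝ)) * ∑ i ∈ Finset.range n, lam.real (T^[i] ⁻¹' s) := by
  simp only [avgM, Measure.real, Measure.smul_apply, Measure.finsetSum_apply, smul_eq_mul]
  rw [ENNReal.toReal_mul, ENNReal.toReal_sum]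
  · simp only [ENNReal.toReal_inv, ENNReal.toReal_natCast, one_div]
    congr 1
    refine Finset.sum_congr rfl fun i _ => ?_
    rw [Measure.map_apply (hT.iterate i) hs]
  · intro i _
    rw [Measure.map_apply (hT.iterate i) hs]
    exact measure_ne_top _ _

lemma avgM_integral (hT : Measurable T) (lam : Measure Ω) [IsProbabilityMeasure lam] {n : ℕ} {f : Ω → ℝ} (hf : Measurable f) {C : ℝ}
    (hC : ∀ x, |f x| ≤ C) :
    ∫ x, f x ∂(avgM T lam n) = (1 / (n : ℝ)) * ∫ x, birk T f n x ∂lam := by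
  have hi : ∀ i, Integrable (fun x => f (T^[i] x)) lam := fun i =>
    Integrable.of_bound (hf.comp (hT.iterate i)).aestronglyMeasurable C
      (Eventually.of_forall fun x => by simpa using hC _)
  have hi' : ∀ i, Integrable f (lam.map T^[i]) := by
    intro i
    exact (integrable_map_measure hf.aestronglyMeasurable (hT.iterate i).aemeasurable).2 (hi i)
  rw [avgM, integral_smul_measure, integral_finsetSum_measure fun i _ => hi' i]
  unfold birk
  rw [integral_finsetSum _ fun i _ => hi i]
  simp only [ENNReal.toReal_inv, ENNReal.toReal_natCast, smul_eq_mul, one_div]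
  congr 1
  refine Finset.sum_congr rfl fun i _ => ?_
  rw [integral_map (hT.iterate i).aemeasurable hf.aestronglyMeasurable]

lemma avgM_ent (hT : Measurable T) (lam : Measure Ω) [IsProbabilityMeasure lam] {α : Type*} [Fintype α] [MeasurableSpace α] [MeasurableSingletonClass α]
    {A : Ω → α} (hA : Measurable A) {n : ℕ} (hn : 1 ≤ n) :
    ∑ i ∈ Finset.range n, ent lam (fun x => A (T^[i] x)) ≤ n * ent (avgM T lam n) A := by
  have hn' : (0 : ℝ) < n := by exact_mod_cast hn
  unfold ent
  rw [Finset.sum_comm, Finset.mul_sum]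
  refine Finset.sum_le_sum fun a _ => ?_
  rw [avgM_real hT lam _ (hA (measurableSet_singleton a))]
  have h := Real.concaveOn_negMulLog.le_map_sum (t := Finset.range n)
    (w := fun _ => 1 / (n : ℝ)) (p := fun i => lam.real (T^[i] ⁻¹' (A ⁻¹' {a})))
    (fun _ _ => by positivity) (by simp [hn'.ne']) (fun i _ => measureReal_nonneg)
  simp only [smul_eq_mul, ← Finset.mul_sum] at h
  rw [one_div_mul_eq_div, div_le_iff₀ hn', mul_comm] at h
  exact h

end Avg

/-! ### Words of a subshift -/

/-- The initial word of length `n`. -/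
def wd {k : ℕ} (X : Set (ℕ → Fin k)) (n : ℕ) (x : X) : Fin n → Fin k := fun i => x.1 i

/-- Split a word. -/
def splitW {k : ℕ} (n m : ℕ) (u : Fin (n + m) → Fin k) : (Fin n → Fin k) × (Fin m → Fin k) :=
  (fun i => u (Fin.castAdd m i), fun i => u (Fin.natAdd n i))

lemma splitW_inj {k : ℕ} (n m : ℕ) : Function.Injective (splitW (k := k) n m) := by
  intro u v h
  simp only [splitW, Prod.mk.injEq] at h
  funext i
  refine Fin.addCases (fun i => congrFun h.1 i) (fun i => congrFun h.2 i) i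

section Words

variable {k : ℕ} {X : Set (ℕ → Fin k)} {σ : X → X}

lemma cyl_eq {n : ℕ} (u : Fin n → Fin k) : cylSet X u = wd X n ⁻¹' {u} := by
  ext x
  simp only [cylSet, Set.mem_preimage, Set.mem_singleton_iff]
  exact funext_iff.symm

lemma wd_eq_iff {n : ℕ} {x y : X} : wd X n x = wd X n y ↔ ∀ i < n, x.1 i = y.1 i := by
  constructor
  · intro h i hi
    exact congrFun h ⟨i, hi⟩
  · intro h
    funext i
    exact h i i.2

lemma wd_cont (n : ℕ) : Continuous (wd X n) := by
  refine continuous_pi fun i => ?_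
  exact (continuous_apply (i : ℕ)).comp continuous_subtype_val

lemma wd_meas (n : ℕ) : Measurable (wd X n) := (wd_cont n).measurable

lemma iter_apply (hσ : ∀ x : X, (σ x).1 = shiftMap x.1) (n : ℕ) (x : X) (i : ℕ) :
    (σ^[n] x).1 i = x.1 (i + n) := by
  induction n generalizing x with
  | zero => rfl
  | succ n ih =>
    rw [Function.iterate_succ_apply, ih, hσ]
    simp only [shiftMap]
    congr 1

lemma shift_cont (hσ : ∀ x : X, (σ x).1 = shiftMap x.1) : Continuous σ := by
  rw [continuous_induced_rng]
  have : (Subtype.val ∘ σ) = fun x : X => shiftMap x.1 := funext hσ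
  rw [this]
  refine continuous_pi fun i => ?_
  exact (continuous_apply (i + 1)).comp continuous_subtype_val

lemma split_wd (hσ : ∀ x : X, (σ x).1 = shiftMap x.1) (n m : ℕ) (x : X) :
    splitW n m (wd X (n + m) x) = (wd X n x, wd X m (σ^[n] x)) := by
  simp only [splitW, wd, Prod.mk.injEq]
  refine ⟨rfl, ?_⟩
  funext i
  change _ = (σ^[n] x).1 i
  rw [iter_apply hσ]
  simp [add_comm]

lemma ent_wd_pair (hσ : ∀ x : X, (σ x).1 = shiftMap x.1) (lam : Measure X)
    [IsProbabilityMeasure lam] (n m : ℕ) :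
    ent lam (wd X (n + m)) = ent lam (fun x => (wd X n x, wd X m (σ^[n] x))) := by
  rw [← ent_comp_inj lam (wd_meas (n + m)) (splitW n m) (splitW_inj n m)]
  simp only [split_wd hσ]

lemma ent_wd_add (hσ : ∀ x : X, (σ x).1 = shiftMap x.1) (lam : Measure X)
    [IsProbabilityMeasure lam] (n m : ℕ) :
    ent lam (wd X (n + m)) ≤ ent lam (wd X n) + ent lam (fun x => wd X m (σ^[n] x)) := by
  rw [ent_wd_pair hσ]
  exact ent_pair_le lam (wd_meas n) ((wd_meas m).comp ((shift_cont hσ).measurable.iterate n))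

lemma ent_wd_mono (lam : Measure X) [IsProbabilityMeasure lam] {n m : ℕ} (h : n ≤ m) :
    ent lam (wd X n) ≤ ent lam (wd X m) :=
  ent_comp_le lam (wd_meas m) (fun u : Fin m → Fin k => fun i : Fin n => u (Fin.castLE h i))

lemma ent_wd_le (lam : Measure X) [IsProbabilityMeasure lam] (n : ℕ) :
    ent lam (wd X n) ≤ n * Real.log k := by
  have := ent_le_log_card lam (wd_meas (X := X) n)
  simpa using this

lemma ent_wd_inv (hσ : ∀ x : X, (σ x).1 = shiftMap x.1) (μ : Measure X) [IsProbabilityMeasure μ]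
    (hμ : MeasurePreserving σ μ μ) (n m : ℕ) :
    ent μ (fun x => wd X m (σ^[n] x)) = ent μ (wd X m) := by
  rw [← ent_map μ ((shift_cont hσ).measurable.iterate n) (wd_meas m), (hμ.iterate n).map_eq]

lemma mEntropy_tendsto (hσ : ∀ x : X, (σ x).1 = shiftMap x.1) (μ : Measure X)
    [IsProbabilityMeasure μ] (hμ : MeasurePreserving σ μ μ) :
    Tendsto (fun n : ℕ => ent μ (wd X n) / n) atTop (𝓝 (mEntropy X μ)) := by
  have hsub : Subadditive (fun n => ent μ (wd X n)) := by
    intro m n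
    refine (ent_wd_add hσ μ m n).trans ?_
    rw [ent_wd_inv hσ μ hμ]
  have h1 := hsub.tendsto_lim ⟨0, by
    rintro _ ⟨n, rfl⟩
    exact div_nonneg (ent_nonneg _ _) (Nat.cast_nonneg _)⟩
  have h2 : mEntropy X μ = hsub.lim := by
    rw [← h1.liminf_eq]
    unfold mEntropy
    congr 1
    funext n
    rw [one_div_mul_eq_div]
    congr 1
    unfold ent
    refine Finset.sum_congr rfl fun u _ => ?_
    rw [cyl_eq]; rfl
  rw [h2]
  exact h1

/-- Misiurewicz's inequality. -/
lemma misiurewicz (hσ : ∀ x : X, (σ x).1 = shiftMap x.1) (lam : Measure X)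
    [IsProbabilityMeasure lam] (n q : ℕ) :
    q * ent lam (wd X n) ≤ ∑ t ∈ Finset.range n, ent lam (fun x => wd X q (σ^[t] x))
      + q * (q * Real.log k) := by
  set H : ℕ → ℝ := fun n => ent lam (wd X n) with hH
  have h1 : ∑ t ∈ Finset.range n, (H (t + q) - H t) ≤
      ∑ t ∈ Finset.range n, ent lam (fun x => wd X q (σ^[t] x)) := by
    refine Finset.sum_le_sum fun t _ => ?_
    have := ent_wd_add hσ lam t q
    simp only [hH]; linarith
  have h2 : ∑ t ∈ Finset.range n, (H (t + q) - H t) =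
      ∑ s ∈ Finset.range q, (H (n + s) - H s) := by
    rw [Finset.sum_sub_distrib, Finset.sum_sub_distrib]
    have e1 := Finset.sum_range_add H n q
    have e2 := Finset.sum_range_add H q n
    rw [add_comm q n] at e2
    have e3 : ∑ t ∈ Finset.range n, H (t + q) = ∑ t ∈ Finset.range n, H (q + t) :=
      Finset.sum_congr rfl fun t _ => by rw [add_comm]
    rw [e3]
    linarith
  have h3 : ∑ s ∈ Finset.range q, (H n - q * Real.log k) ≤
      ∑ s ∈ Finset.range q, (H (n + s) - H s) := by
    refine Finset.sum_le_sum fun s hs => ?_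
    have a : H n ≤ H (n + s) := ent_wd_mono lam (by omega)
    have b : H s ≤ H q := ent_wd_mono lam (Finset.mem_range.1 hs).le
    have c : H q ≤ q * Real.log k := ent_wd_le lam q
    linarith
  simp only [Finset.sum_const, Finset.card_range, nsmul_eq_mul] at h3
  linarith

lemma measure_ext_wd (μ ν : Measure X) [IsProbabilityMeasure μ] [IsProbabilityMeasure ν]
    (h : ∀ n (u : Fin n → Fin k), μ.real (wd X n ⁻¹' {u}) = ν.real (wd X n ⁻¹' {u})) : μ = ν := by
  refine ext_of_generate_finite {s | ∃ n, ∃ u : Fin n → Fin k, s = wd X n ⁻¹' {u}} ?_ ?_ ?_ ?_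
  · refine le_antisymm ?_ ?_
    · have key : @Measurable X (ℕ → Fin k)
          (MeasurableSpace.generateFrom {s | ∃ n, ∃ u : Fin n → Fin k, s = wd X n ⁻¹' {u}}) _
          Subtype.val := by
        refine @measurable_pi_lambda _ _ _ (_) _ _ ?_
        intro i
        refine @measurable_to_countable' _ _ _ _ (_) _ fun a => ?_
        have : (fun x : X => x.1 i) ⁻¹' {a} =
            ⋃ u : Fin (i + 1) → Fin k, ⋃ _ : u (Fin.last i) = a, wd X (i + 1) ⁻¹' {u} := by
          ext x
          simp only [Set.mem_preimage, Set.mem_singleton_iff, Set.mem_iUnion, exists_prop]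
          constructor
          · intro hx
            exact ⟨wd X (i + 1) x, by simpa [wd] using hx, rfl⟩
          · rintro ⟨u, hu, hx⟩
            rw [← hu, ← hx]
            simp [wd]
        rw [this]
        refine @MeasurableSet.iUnion _ _ (_) _ _ fun u => @MeasurableSet.iUnion _ _ (_) _ _ fun _ => ?_
        exact MeasurableSpace.measurableSet_generateFrom ⟨i + 1, u, rfl⟩
      exact measurable_iff_comap_le.1 key
    · refine MeasurableSpace.generateFrom_le ?_
      rintro _ ⟨n, u, rfl⟩
      exact wd_meas n (measurableSet_singleton u)
  · have key : ∀ n m (u : Fin n → Fin k) (v : Fin m → Fin k), n ≤ m →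
        (wd X n ⁻¹' {u} ∩ wd X m ⁻¹' {v}).Nonempty →
        wd X n ⁻¹' {u} ∩ wd X m ⁻¹' {v} = wd X m ⁻¹' {v} := by
      rintro n m u v hnm ⟨x, hx1, hx2⟩
      refine Set.inter_eq_right.2 fun z hz => ?_
      simp only [Set.mem_preimage, Set.mem_singleton_iff] at *
      rw [← hx1, wd_eq_iff]
      rw [← hx2, wd_eq_iff] at hz
      exact fun i hi => hz i (by omega)
    rintro _ ⟨n, u, rfl⟩ _ ⟨m, v, rfl⟩ hne
    rcases le_total n m with hnm | hnm
    · exact ⟨m, v, key n m u v hnm hne⟩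
    · rw [Set.inter_comm] at hne ⊢
      exact ⟨n, u, key m n v u hnm hne⟩
  · rintro _ ⟨n, u, rfl⟩
    have := h n u
    rwa [Measure.real, Measure.real, ENNReal.toReal_eq_toReal_iff' (measure_ne_top _ _)
      (measure_ne_top _ _)] at this
  · simp

end Words

/-! ### Fibrewise suprema -/

/-- Supremum of `exp (S_n f)` over `[u] ∩ F`. -/
noncomputable def esup {k : ℕ} {X : Set (ℕ → Fin k)} (σ : X → X) (f : X → ℝ) (n : ℕ)
    (u : Fin n → Fin k) (F : Set X) : ℝ :=
  sSup ((fun x => Real.exp (birk σ f n x)) '' (wd X n ⁻¹' {u} ∩ F))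

/-- Sum over words of the suprema of `exp (S_n f)`. -/
noncomputable def Rsup {k : ℕ} {X : Set (ℕ → Fin k)} (σ : X → X) (f : X → ℝ) (n : ℕ)
    (F : Set X) : ℝ :=
  ∑ u, esup σ f n u F

lemma sum_le_of_injOn {ι α : Type*} [Fintype α] (E : Finset ι) (g : ι → α)
    (hg : Set.InjOn g E) (Φ : α → ℝ) (hΦ : ∀ a, 0 ≤ Φ a) :
    ∑ x ∈ E, Φ (g x) ≤ ∑ a, Φ a := by
  classical
  rw [← Finset.sum_image hg]
  exact Finset.sum_le_sum_of_subset_of_nonneg (Finset.subset_univ _) fun a _ _ => hΦ a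

section Esup

variable {k : ℕ} {X : Set (ℕ → Fin k)} {σ : X → X} {f : X → ℝ} {M : ℝ}

lemma exp_birk_le (hM : ∀ x, |f x| ≤ M) (n : ℕ) (x : X) :
    Real.exp (birk σ f n x) ≤ Real.exp (n * M) :=
  Real.exp_le_exp.2 (abs_le.1 (birk_abs_le σ f M hM n x)).2

lemma exp_birk_ge (hM : ∀ x, |f x| ≤ M) (n : ℕ) (x : X) :
    Real.exp (-(n * M)) ≤ Real.exp (birk σ f n x) :=
  Real.exp_le_exp.2 (abs_le.1 (birk_abs_le σ f M hM n x)).1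

lemma esup_bdd (hM : ∀ x, |f x| ≤ M) (n : ℕ) (s : Set X) :
    BddAbove ((fun x => Real.exp (birk σ f n x)) '' s) := by
  refine ⟨Real.exp (n * M), ?_⟩
  rintro _ ⟨x, _, rfl⟩
  exact exp_birk_le hM n x

lemma esup_nonneg (n : ℕ) (u : Fin n → Fin k) (F : Set X) : 0 ≤ esup σ f n u F := by
  refine Real.sSup_nonneg ?_
  rintro _ ⟨x, _, rfl⟩
  exact (Real.exp_pos _).le

lemma le_esup (hM : ∀ x, |f x| ≤ M) {n : ℕ} {x : X} {F : Set X} (hx : x ∈ F) :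
    Real.exp (birk σ f n x) ≤ esup σ f n (wd X n x) F :=
  le_csSup (esup_bdd hM n _) ⟨x, ⟨rfl, hx⟩, rfl⟩

lemma esup_le {n : ℕ} {u : Fin n → Fin k} {F : Set X} {a : ℝ} (ha : 0 ≤ a)
    (h : ∀ x ∈ F, wd X n x = u → Real.exp (birk σ f n x) ≤ a) : esup σ f n u F ≤ a := by
  refine Real.sSup_le ?_ ha
  rintro _ ⟨x, ⟨hx1, hx2⟩, rfl⟩
  exact h x hx2 hx1

lemma esup_mono (hM : ∀ x, |f x| ≤ M) {n : ℕ} {u : Fin n → Fin k} {F F' : Set X} (h : F ⊆ F') :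
    esup σ f n u F ≤ esup σ f n u F' := by
  refine esup_le (esup_nonneg _ _ _) ?_
  rintro x hx rfl
  exact le_esup hM (h hx)

lemma Rsup_mono (hM : ∀ x, |f x| ≤ M) {n : ℕ} {F F' : Set X} (h : F ⊆ F') :
    Rsup σ f n F ≤ Rsup σ f n F' :=
  Finset.sum_le_sum fun _ _ => esup_mono hM h

lemma Rsup_le (hM : ∀ x, |f x| ≤ M) (n : ℕ) (F : Set X) :
    Rsup σ f n F ≤ (k : ℝ) ^ n * Real.exp (n * M) := by
  have : Rsup σ f n F ≤ ∑ u : Fin n → Fin k, Real.exp (n * M) :=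
    Finset.sum_le_sum fun u _ => esup_le (Real.exp_pos _).le fun x _ _ => exp_birk_le hM n x
  simpa using this

lemma esup_le_Rsup (n : ℕ) (u : Fin n → Fin k) (F : Set X) :
    esup σ f n u F ≤ Rsup σ f n F :=
  Finset.single_le_sum (f := fun u => esup σ f n u F) (fun u _ => esup_nonneg n u F)
    (Finset.mem_univ u)

lemma le_Rsup (hM : ∀ x, |f x| ≤ M) (n : ℕ) {F : Set X} (hF : F.Nonempty) :
    Real.exp (-(n * M)) ≤ Rsup σ f n F := by
  obtain ⟨x, hx⟩ := hF
  exact (exp_birk_ge hM n x).trans ((le_esup hM hx).trans (esup_le_Rsup n _ F))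

lemma Rsup_pos (hM : ∀ x, |f x| ≤ M) (n : ℕ) {F : Set X} (hF : F.Nonempty) :
    0 < Rsup σ f n F := (Real.exp_pos _).trans_le (le_Rsup hM n hF)

lemma k_pos (x : X) : 0 < k := (x.1 0).pos

lemma Rsup_log (hM : ∀ x, |f x| ≤ M) (n : ℕ) {F : Set X} (hF : F.Nonempty) :
    |Real.log (Rsup σ f n F)| ≤ n * (M + Real.log k) := by
  have hk : 0 < k := k_pos hF.some
  have hk' : (0 : ℝ) < k := by exact_mod_cast hk
  have h1 := Real.log_le_log (Real.exp_pos _) (le_Rsup (σ := σ) hM n hF)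
  have h2 := Real.log_le_log (Rsup_pos (σ := σ) hM n hF) (Rsup_le hM n F)
  rw [Real.log_exp] at h1
  rw [Real.log_mul (by positivity) (Real.exp_pos _).ne', Real.log_exp, Real.log_pow] at h2
  have h3 : 0 ≤ (n : ℝ) * Real.log k := mul_nonneg (Nat.cast_nonneg _) (Real.log_natCast_nonneg k)
  rw [abs_le]
  constructor <;> linarith

lemma birk_cont (hσ : Continuous σ) (hf : Continuous f) (n : ℕ) : Continuous (birk σ f n) := by
  unfold birk
  exact continuous_finsetSum _ fun i _ => hf.comp (hσ.iterate i)

lemma cyl_clopen (n : ℕ) (u : Fin n → Fin k) : IsClopen (wd X n ⁻¹' {u}) :=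
  (isClopen_discrete {u}).preimage (wd_cont n)

lemma compact_X (hX : IsSubshift X) : CompactSpace X :=
  isCompact_iff_compactSpace.1 hX.1.isCompact

lemma esup_attained (hX : IsSubshift X) (hσ : Continuous σ) (hf : Continuous f) {n : ℕ}
    {u : Fin n → Fin k} {F : Set X} (hF : IsClosed F) (hne : (wd X n ⁻¹' {u} ∩ F).Nonempty) :
    ∃ x ∈ F, wd X n x = u ∧ esup σ f n u F = Real.exp (birk σ f n x) := by
  have := compact_X hX
  have hc : IsCompact (wd X n ⁻¹' {u} ∩ F) := ((cyl_clopen n u).1.inter hF).isCompact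
  obtain ⟨x, hx, hx'⟩ := hc.exists_sSup_image_eq hne
    (Real.continuous_exp.comp (birk_cont hσ hf n)).continuousOn
  exact ⟨x, hx.2, hx.1, hx'⟩

lemma esup_tendsto (hX : IsSubshift X) (hσ : Continuous σ) (hf : Continuous f)
    (hM : ∀ x, |f x| ≤ M) (n : ℕ) (u : Fin n → Fin k) (F : ℕ → Set X) (hF : Antitone F)
    (hFc : ∀ m, IsClosed (F m)) :
    Tendsto (fun m => esup σ f n u (F m)) atTop (𝓝 (esup σ f n u (⋂ m, F m))) := by
  have := compact_X hX
  rw [Metric.tendsto_atTop]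
  intro ε hε
  set a := esup σ f n u (⋂ m, F m) with ha
  have ha0 : 0 ≤ a := esup_nonneg _ _ _
  set K : ℕ → Set X := fun m => (wd X n ⁻¹' {u} ∩ F m) ∩ {x | a + ε / 2 ≤ Real.exp (birk σ f n x)}
    with hK
  have hKc : ∀ m, IsClosed (K m) := fun m => ((cyl_clopen n u).1.inter (hFc m)).inter
    (isClosed_le continuous_const (Real.continuous_exp.comp (birk_cont hσ hf n)))
  have hex : ∃ m, K m = ∅ := by
    by_contra hcon
    push Not at hcon
    have := IsCompact.nonempty_iInter_of_sequence_nonempty_isCompact_isClosed K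
      (fun m x hx => ⟨⟨hx.1.1, hF (Nat.le_succ m) hx.1.2⟩, hx.2⟩)
      (fun m => hcon m) (hKc 0).isCompact hKc
    obtain ⟨x, hx⟩ := this
    rw [Set.mem_iInter] at hx
    have h1 : x ∈ ⋂ m, F m := Set.mem_iInter.2 fun m => (hx m).1.2
    have h2 : wd X n x = u := (hx 0).1.1
    have h3 : a + ε / 2 ≤ Real.exp (birk σ f n x) := (hx 0).2
    have h4 := le_esup (σ := σ) hM (n := n) h1
    rw [h2] at h4
    linarith
  obtain ⟨m0, hm0⟩ := hex
  refine ⟨m0, fun m hm => ?_⟩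
  have h1 : a ≤ esup σ f n u (F m) := esup_mono hM (Set.iInter_subset F m)
  have h2 : esup σ f n u (F m) ≤ a + ε / 2 := by
    refine esup_le (by linarith) fun x hx hxu => ?_
    by_contra hcon
    push Not at hcon
    have : x ∈ K m0 := ⟨⟨hxu, hF hm hx⟩, hcon.le⟩
    rw [hm0] at this
    exact this
  rw [Real.dist_eq, abs_lt]
  constructor <;> linarith

end Esup

/-! ### The factor map -/

/-- The standing assumptions, gathered. -/
structure FCtx {k l : ℕ} (X : Set (ℕ → Fin k)) (Y : Set (ℕ → Fin l)) (σX : X → X) (σY : Y → Y)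
    (π : X → Y) (τ : Fin k → Fin l) (f : X → ℝ) (M : ℝ) : Prop where
  hX : IsSubshift X
  hσX : ∀ x : X, (σX x).1 = shiftMap x.1
  hσY : ∀ y : Y, (σY y).1 = shiftMap y.1
  hπc : Continuous π
  hπs : Function.Surjective π
  hcomm : ∀ x, π (σX x) = σY (π x)
  hτ : ∀ (x : X) (i : ℕ), (π x).1 i = τ (x.1 i)
  hf : Continuous f
  hM : ∀ x, |f x| ≤ M

/-- Points of `X` whose image agrees with `y` up to `m` coordinates. -/
def fibM {k l : ℕ} {X : Set (ℕ → Fin k)} {Y : Set (ℕ → Fin l)} (π : X → Y) (m : ℕ) (y : Y) :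
    Set X := {x | wd Y m (π x) = wd Y m y}

/-- The fibre over `y`. -/
def fibI {k l : ℕ} {X : Set (ℕ → Fin k)} {Y : Set (ℕ → Fin l)} (π : X → Y) (y : Y) :
    Set X := {x | π x = y}

section Factor

variable {k l : ℕ} {X : Set (ℕ → Fin k)} {Y : Set (ℕ → Fin l)} {σX : X → X} {σY : Y → Y}
    {π : X → Y} {τ : Fin k → Fin l} {f : X → ℝ} {M : ℝ}

lemma FCtx.comm_iter (c : FCtx X Y σX σY π τ f M) (n : ℕ) (x : X) :
    π (σX^[n] x) = σY^[n] (π x) := by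
  induction n generalizing x with
  | zero => rfl
  | succ n ih => rw [Function.iterate_succ_apply, Function.iterate_succ_apply, ih, c.hcomm]

lemma FCtx.fibI_ne (c : FCtx X Y σX σY π τ f M) (y : Y) : (fibI π y).Nonempty := c.hπs y

lemma FCtx.fibM_ne (c : FCtx X Y σX σY π τ f M) (m : ℕ) (y : Y) : (fibM π m y).Nonempty := by
  obtain ⟨x, rfl⟩ := c.hπs y
  exact ⟨x, rfl⟩

lemma fibI_sub (m : ℕ) (y : Y) : fibI π y ⊆ fibM π m y := by
  rintro x rfl
  rfl

lemma FCtx.fibI_closed (c : FCtx X Y σX σY π τ f M) (y : Y) : IsClosed (fibI π y) :=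
  isClosed_singleton.preimage c.hπc

lemma FCtx.fibM_closed (c : FCtx X Y σX σY π τ f M) (m : ℕ) (y : Y) : IsClosed (fibM π m y) :=
  (cyl_clopen m (wd Y m y)).1.preimage c.hπc

lemma fibM_anti (y : Y) : Antitone fun m => fibM π m y := by
  intro m m' h x hx
  simp only [fibM] at *
  have hx' : wd Y m' (π x) = wd Y m' y := hx
  change wd Y m (π x) = wd Y m y
  rw [wd_eq_iff] at *
  exact fun i hi => hx' i (by omega)

lemma fibM_iInter (y : Y) : ⋂ m, fibM π m y = fibI π y := by
  refine Set.Subset.antisymm ?_ (Set.subset_iInter fun m => fibI_sub m y)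
  intro x hx
  rw [Set.mem_iInter] at hx
  change π x = y
  refine Subtype.ext (funext fun i => ?_)
  have : wd Y (i + 1) (π x) = wd Y (i + 1) y := hx (i + 1)
  exact wd_eq_iff.1 this i (by omega)

lemma FCtx.Rsup_tendsto (c : FCtx X Y σX σY π τ f M) (n : ℕ) (y : Y) :
    Tendsto (fun m => Rsup σX f n (fibM π m y)) atTop (𝓝 (Rsup σX f n (fibI π y))) := by
  unfold Rsup
  refine tendsto_finsetSum _ fun u _ => ?_
  have := esup_tendsto c.hX (shift_cont c.hσX) c.hf c.hM n u (fun m => fibM π m y) (fibM_anti y)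
    (fun m => c.fibM_closed m y)
  rwa [fibM_iInter] at this

lemma Rsup_fibM_cont (n m : ℕ) : Continuous fun y : Y => Rsup σX f n (fibM π m y) := by
  have : (fun y : Y => Rsup σX f n (fibM π m y)) =
      (fun v : Fin m → Fin l => Rsup σX f n {x | wd Y m (π x) = v}) ∘ (wd Y m) := rfl
  rw [this]
  exact continuous_of_discreteTopology.comp (wd_cont m)

lemma FCtx.Rsup_fibI_meas (c : FCtx X Y σX σY π τ f M) (n : ℕ) :
    Measurable fun y : Y => Rsup σX f n (fibI π y) :=
  measurable_of_tendsto_metrizable (fun m => (Rsup_fibM_cont n m).measurable)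
    (tendsto_pi_nhds.2 fun y => c.Rsup_tendsto n y)

/-- Submultiplicativity. -/
lemma FCtx.Rsup_add (c : FCtx X Y σX σY π τ f M) (n m : ℕ) (y : Y) :
    Rsup σX f (n + m) (fibM π (n + m) y) ≤
      Rsup σX f n (fibM π n y) * Rsup σX f m (fibM π m (σY^[n] y)) := by
  have h1 : ∀ w : Fin (n + m) → Fin k, esup σX f (n + m) w (fibM π (n + m) y) ≤
      (fun p : (Fin n → Fin k) × (Fin m → Fin k) =>
        esup σX f n p.1 (fibM π n y) * esup σX f m p.2 (fibM π m (σY^[n] y))) (splitW n m w) := by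
    intro w
    refine esup_le (mul_nonneg (esup_nonneg _ _ _) (esup_nonneg _ _ _)) ?_
    rintro x hx rfl
    rw [split_wd c.hσX, birk_add, Real.exp_add]
    have hx1 : x ∈ fibM π n y := fibM_anti y (by omega : n ≤ n + m) hx
    have hx2 : σX^[n] x ∈ fibM π m (σY^[n] y) := by
      change wd Y m (π (σX^[n] x)) = wd Y m (σY^[n] y)
      have hx' : wd Y (n + m) (π x) = wd Y (n + m) y := hx
      rw [c.comm_iter]
      have e1 := split_wd c.hσY n m (π x)
      have e2 := split_wd c.hσY n m y
      rw [hx', e2] at e1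
      exact (Prod.mk.inj e1).2.symm
    exact mul_le_mul (le_esup c.hM hx1) (le_esup c.hM hx2) (Real.exp_pos _).le (esup_nonneg _ _ _)
  refine (Finset.sum_le_sum fun w _ => h1 w).trans ?_
  refine (sum_le_of_injOn Finset.univ (splitW n m) (splitW_inj n m).injOn _
    fun p => mul_nonneg (esup_nonneg _ _ _) (esup_nonneg _ _ _)).trans (le_of_eq ?_)
  rw [Fintype.sum_prod_type, Rsup, Rsup, Finset.sum_mul_sum]

/-! ### Relation with the relative pressure -/

lemma dSeq_lt {x y : ℕ → Fin k} {m : ℕ} {δ : ℝ} (hδ : 0 < δ) (hm : (1 / 2 : ℝ) ^ m < δ)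
    (h : ∀ i < m, x i = y i) : dSeq x y < δ := by
  unfold dSeq
  split_ifs with hxy
  · exact hδ
  · have hne : {i : ℕ | x i ≠ y i}.Nonempty := by
      by_contra hcon
      rw [Set.not_nonempty_iff_eq_empty, Set.eq_empty_iff_forall_notMem] at hcon
      refine hxy (funext fun i => ?_)
      by_contra hi
      exact hcon i hi
    have h1 : m ≤ sInf {i : ℕ | x i ≠ y i} := by
      by_contra hcon
      push Not at hcon
      exact Nat.sInf_mem hne (h _ hcon)
    exact (pow_le_pow_of_le_one (by norm_num) (by norm_num) h1).trans_lt hm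

lemma dSeq_ge {x y : ℕ → Fin k} (h : x 0 ≠ y 0) : 1 ≤ dSeq x y := by
  unfold dSeq
  split_ifs with hxy
  · exact absurd (congrFun hxy 0) h
  · have : sInf {i : ℕ | x i ≠ y i} = 0 := Nat.sInf_eq_zero.2 (Or.inl h)
    rw [this]; simp

lemma FCtx.sep_le (c : FCtx X Y σX σY π τ f M) {n m : ℕ} {δ : ℝ} (hδ : 0 < δ)
    (hm : (1 / 2 : ℝ) ^ m < δ) (y : Y) (E : Finset X)
    (hE : ∀ x ∈ E, (π x).1 = y.1)
    (hsep : ∀ x ∈ E, ∀ x' ∈ E, x ≠ x' →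
      ∃ i < n, δ ≤ dSeq ((σX^[i] x : X) : ℕ → Fin k) ((σX^[i] x' : X) : ℕ → Fin k)) :
    ∑ x ∈ E, Real.exp (birk σX f n x) ≤ (k : ℝ) ^ m * Rsup σX f n (fibM π n y) := by
  have hinj : Set.InjOn (fun x : X => (wd X n x, wd X m (σX^[n] x))) E := by
    intro x hx x' hx' hxx
    by_contra hne
    obtain ⟨i, hi, hd⟩ := hsep x hx x' hx' hne
    refine absurd hd (not_le.2 (dSeq_lt hδ hm fun j hj => ?_))
    have h1 : wd X (n + m) x = wd X (n + m) x' := by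
      refine splitW_inj n m ?_
      rw [split_wd c.hσX, split_wd c.hσX]
      exact hxx
    rw [iter_apply c.hσX, iter_apply c.hσX]
    exact wd_eq_iff.1 h1 _ (by omega)
  calc ∑ x ∈ E, Real.exp (birk σX f n x)
      ≤ ∑ x ∈ E, (fun p : (Fin n → Fin k) × (Fin m → Fin k) => esup σX f n p.1 (fibM π n y))
          (wd X n x, wd X m (σX^[n] x)) := by
        refine Finset.sum_le_sum fun x hx => le_esup c.hM ?_
        exact fibI_sub n y (Subtype.ext (hE x hx))
    _ ≤ _ := sum_le_of_injOn E _ hinj _ fun p => esup_nonneg _ _ _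
    _ = (k : ℝ) ^ m * Rsup σX f n (fibM π n y) := by
        rw [Fintype.sum_prod_type, Rsup]
        simp [Finset.mul_sum]

lemma FCtx.relPn_bdd (c : FCtx X Y σX σY π τ f M) {n m : ℕ} {δ : ℝ} (hδ : 0 < δ)
    (hm : (1 / 2 : ℝ) ^ m < δ) (y : Y) :
    BddAbove {s : ℝ | ∃ E : Finset X, (∀ x ∈ E, (fun z => (π z).1) x = y.1) ∧
    (∀ x ∈ E, ∀ x' ∈ E, x ≠ x' →
      ∃ i < n, δ ≤ dSeq ((σX^[i] x : X) : ℕ → Fin k) ((σX^[i] x' : X) : ℕ → Fin k)) ∧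
    s = ∑ x ∈ E, Real.exp (birk σX f n x)} := by
  refine ⟨(k : ℝ) ^ m * Rsup σX f n (fibM π n y), ?_⟩
  rintro _ ⟨E, h1, h2, rfl⟩
  exact c.sep_le hδ hm y E h1 h2

lemma FCtx.relPn_le (c : FCtx X Y σX σY π τ f M) {n m : ℕ} {δ : ℝ} (hδ : 0 < δ)
    (hm : (1 / 2 : ℝ) ^ m < δ) (y : Y) :
    relPn X σX (fun z => (π z).1) f n δ y.1 ≤ (k : ℝ) ^ m * Rsup σX f n (fibM π n y) := by
  refine csSup_le ⟨0, ∅, by simp⟩ ?_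
  rintro _ ⟨E, h1, h2, rfl⟩
  exact c.sep_le hδ hm y E h1 h2

lemma FCtx.le_relPn (c : FCtx X Y σX σY π τ f M) {n m : ℕ} {δ : ℝ} (hδ : 0 < δ)
    (hm : (1 / 2 : ℝ) ^ m < δ) (y : Y) :
    Real.exp (-(n * M)) ≤ relPn X σX (fun z => (π z).1) f n δ y.1 := by
  obtain ⟨x, rfl⟩ := c.hπs y
  refine (exp_birk_ge (σ := σX) c.hM n x).trans (le_csSup (c.relPn_bdd hδ hm (π x)) ?_)
  refine ⟨{x}, by simp, ?_, by simp⟩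
  intro a ha b hb hab
  rw [Finset.mem_singleton] at ha hb
  exact absurd (ha.trans hb.symm) hab

lemma FCtx.relPn_one_ge (c : FCtx X Y σX σY π τ f M) (n : ℕ) (y : Y) :
    Rsup σX f n (fibI π y) ≤ relPn X σX (fun z => (π z).1) f n 1 y.1 := by
  classical
  obtain ⟨x0, hx0⟩ := c.hπs y
  have hex : ∀ u : Fin n → Fin k, ∃ x : X, (wd X n ⁻¹' {u} ∩ fibI π y).Nonempty →
      x ∈ fibI π y ∧ wd X n x = u ∧ esup σX f n u (fibI π y) = Real.exp (birk σX f n x) := by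
    intro u
    by_cases h : (wd X n ⁻¹' {u} ∩ fibI π y).Nonempty
    · obtain ⟨x, h1, h2, h3⟩ := esup_attained c.hX (shift_cont c.hσX) c.hf (c.fibI_closed y) h
      exact ⟨x, fun _ => ⟨h1, h2, h3⟩⟩
    · exact ⟨x0, fun h' => absurd h' h⟩
  choose z hz using hex
  set S : Finset (Fin n → Fin k) :=
    Finset.univ.filter fun u => (wd X n ⁻¹' {u} ∩ fibI π y).Nonempty with hS
  have hSz : ∀ u ∈ S, z u ∈ fibI π y ∧ wd X n (z u) = u ∧
      esup σX f n u (fibI π y) = Real.exp (birk σX f n (z u)) := by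
    intro u hu
    exact hz u (Finset.mem_filter.1 hu).2
  have hinj : Set.InjOn z S := by
    intro u hu v hv huv
    rw [← (hSz u hu).2.1, ← (hSz v hv).2.1, huv]
  refine le_csSup (c.relPn_bdd one_pos (m := 1) (by norm_num) y) ⟨S.image z, ?_, ?_, ?_⟩
  · intro x hx
    obtain ⟨u, hu, rfl⟩ := Finset.mem_image.1 hx
    exact congrArg Subtype.val (hSz u hu).1
  · intro x hx x' hx' hne
    obtain ⟨u, hu, rfl⟩ := Finset.mem_image.1 hx
    obtain ⟨v, hv, rfl⟩ := Finset.mem_image.1 hx'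
    have huv : wd X n (z u) ≠ wd X n (z v) := by
      rw [(hSz u hu).2.1, (hSz v hv).2.1]
      rintro rfl
      exact hne rfl
    rw [Ne, wd_eq_iff] at huv
    push Not at huv
    obtain ⟨i, hi, h⟩ := huv
    refine ⟨i, hi, dSeq_ge ?_⟩
    rw [iter_apply c.hσX, iter_apply c.hσX]
    simpa using h
  · rw [Finset.sum_image hinj]
    rw [Rsup, ← Finset.sum_subset (Finset.subset_univ S)]
    · exact Finset.sum_congr rfl fun u hu => (hSz u hu).2.2
    · intro u _ hu
      have : wd X n ⁻¹' {u} ∩ fibI π y = ∅ := by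
        rw [← Set.not_nonempty_iff_eq_empty]
        intro h
        exact hu (Finset.mem_filter.2 ⟨Finset.mem_univ _, h⟩)
      rw [esup, this]
      simp

/-- Lower function. -/
noncomputable def Lfun (σX : X → X) (π : X → Y) (f : X → ℝ) (y : Y) : ℝ :=
  limsup (fun n : ℕ => (1 / (n : ℝ)) * Real.log (Rsup σX f n (fibI π y))) atTop

/-- Upper function. -/
noncomputable def Ufun (σX : X → X) (π : X → Y) (f : X → ℝ) (y : Y) : ℝ :=
  limsup (fun n : ℕ => (1 / (n : ℝ)) * Real.log (Rsup σX f n (fibM π n y))) atTop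

lemma FCtx.C_nonneg (c : FCtx X Y σX σY π τ f M) (y : Y) : 0 ≤ M + Real.log k := by
  obtain ⟨x, _⟩ := c.hπs y
  exact add_nonneg ((abs_nonneg _).trans (c.hM x)) (Real.log_natCast_nonneg k)

lemma FCtx.avgI (c : FCtx X Y σX σY π τ f M) (n : ℕ) (y : Y) :
    |(1 / (n : ℝ)) * Real.log (Rsup σX f n (fibI π y))| ≤ M + Real.log k :=
  avg_abs_le (Rsup_log c.hM n (c.fibI_ne y)) (c.C_nonneg y)

lemma FCtx.avgU (c : FCtx X Y σX σY π τ f M) (n m : ℕ) (y : Y) :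
    |(1 / (n : ℝ)) * Real.log (Rsup σX f n (fibM π m y))| ≤ M + Real.log k :=
  avg_abs_le (Rsup_log c.hM n (c.fibM_ne m y)) (c.C_nonneg y)

lemma FCtx.log_relPn_le (c : FCtx X Y σX σY π τ f M) {n m : ℕ} {δ : ℝ} (hδ : 0 < δ)
    (hm : (1 / 2 : ℝ) ^ m < δ) (y : Y) :
    Real.log (relPn X σX (fun z => (π z).1) f n δ y.1) ≤
      m * Real.log k + Real.log (Rsup σX f n (fibM π n y)) := by
  have hk : (0 : ℝ) < k := by exact_mod_cast k_pos (c.hπs y).choose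
  rw [← Real.log_pow, ← Real.log_mul (by positivity) (Rsup_pos c.hM n (c.fibM_ne n y)).ne']
  exact Real.log_le_log ((Real.exp_pos _).trans_le (c.le_relPn hδ hm y)) (c.relPn_le hδ hm y)

lemma FCtx.avg_relPn (c : FCtx X Y σX σY π τ f M) {m : ℕ} {δ : ℝ} (hδ : 0 < δ)
    (hm : (1 / 2 : ℝ) ^ m < δ) (y : Y) (n : ℕ) :
    |(1 / (n : ℝ)) * Real.log (relPn X σX (fun z => (π z).1) f n δ y.1)| ≤
      M + Real.log k + m * Real.log k := by
  have hk : 0 ≤ Real.log k := Real.log_natCast_nonneg k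
  have hmk : 0 ≤ m * Real.log k := by positivity
  have h0 : 0 ≤ M + Real.log k + m * Real.log k := by linarith [c.C_nonneg y]
  rcases Nat.eq_zero_or_pos n with rfl | hn
  · simpa using h0
  · have hn' : (1 : ℝ) ≤ n := by exact_mod_cast hn
    refine avg_abs_le ?_ h0
    have h1 := c.log_relPn_le (n := n) hδ hm y
    have h2 := (abs_le.1 (Rsup_log (σ := σX) c.hM n (c.fibM_ne n y))).2
    have h3 := Real.log_le_log (Real.exp_pos _) (c.le_relPn (n := n) hδ hm y)
    rw [Real.log_exp] at h3
    have h4 : m * Real.log k ≤ n * (m * Real.log k) := le_mul_of_one_le_left hmk hn'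
    have h5 : 0 ≤ n * Real.log k := by positivity
    rw [abs_le]
    constructor <;> linarith

lemma exists_half_pow {δ : ℝ} (hδ : 0 < δ) : ∃ m : ℕ, (1 / 2 : ℝ) ^ m < δ :=
  exists_pow_lt_of_lt_one hδ (by norm_num)

lemma FCtx.limsup_relPn_le (c : FCtx X Y σX σY π τ f M) {δ : ℝ} (hδ : 0 < δ) (y : Y) :
    limsup (fun n : ℕ => (1 / (n : ℝ)) * Real.log (relPn X σX (fun z => (π z).1) f n δ y.1)) atTop
      ≤ Ufun σX π f y := by
  obtain ⟨m, hm⟩ := exists_half_pow hδ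
  refine limsup_le_limsup_add (e := fun n : ℕ => m * Real.log k / n) (fun n => c.avgU n n y)
    (c.avg_relPn hδ hm y) (tendsto_const_div_atTop_nhds_zero_nat _) ?_
  refine Eventually.of_forall fun n => ?_
  rw [one_div_mul_eq_div, one_div_mul_eq_div, ← add_div]
  have := c.log_relPn_le (n := n) hδ hm y
  gcongr
  linarith

lemma FCtx.relP_le (c : FCtx X Y σX σY π τ f M) (y : Y) :
    relP X σX (fun z => (π z).1) f y.1 ≤ Ufun σX π f y := by
  have : Nonempty {δ : ℝ // 0 < δ} := ⟨⟨1, one_pos⟩⟩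
  exact ciSup_le fun δ => c.limsup_relPn_le δ.2 y

lemma FCtx.le_relP (c : FCtx X Y σX σY π τ f M) (y : Y) :
    Lfun σX π f y ≤ relP X σX (fun z => (π z).1) f y.1 := by
  have hb : BddAbove (Set.range fun δ : {δ : ℝ // 0 < δ} =>
    limsup (fun n : ℕ => (1 / (n : ℝ)) * Real.log (relPn X σX (fun z => (π z).1) f n δ.1 y.1))
      atTop) := by
    refine ⟨Ufun σX π f y, ?_⟩
    rintro _ ⟨δ, rfl⟩
    exact c.limsup_relPn_le δ.2 y
  refine le_trans ?_ (le_ciSup hb ⟨1, one_pos⟩)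
  refine limsup_le_limsup_add (e := fun _ => 0)
    (c.avg_relPn one_pos (m := 1) (by norm_num) y) (fun n => c.avgI n y) tendsto_const_nhds ?_
  refine Eventually.of_forall fun n => ?_
  rw [add_zero]
  have := Real.log_le_log (Rsup_pos (σ := σX) c.hM n (c.fibI_ne y)) (c.relPn_one_ge n y)
  gcongr

/-- The integral of the upper function is at most every normalised integral. -/
lemma FCtx.Ufun_integral (c : FCtx X Y σX σY π τ f M) (ν : Measure Y) [IsProbabilityMeasure ν]
    (hν : MeasurePreserving σY ν ν) (N : ℕ) (hN : 1 ≤ N) :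
    ∫ y, Ufun σX π f y ∂ν ≤ (1 / (N : ℝ)) * ∫ y, Real.log (Rsup σX f N (fibM π N y)) ∂ν := by
  obtain ⟨y0⟩ : Nonempty Y := nonempty_of_isProbabilityMeasure ν
  set C := M + Real.log k with hC
  have hC0 : 0 ≤ C := c.C_nonneg y0
  set G : ℕ → Y → ℝ := fun n y => Real.log (Rsup σX f n (fibM π n y)) with hG
  have hGC : ∀ n y, |G n y| ≤ n * C := fun n y => Rsup_log c.hM n (c.fibM_ne n y)
  have hGadd : ∀ n m y, G (n + m) y ≤ G n y + G m (σY^[n] y) := by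
    intro n m y
    have h1 := Rsup_pos (σ := σX) c.hM n (c.fibM_ne n y)
    have h2 := Rsup_pos (σ := σX) c.hM m (c.fibM_ne m (σY^[n] y))
    have h3 := Rsup_pos (σ := σX) c.hM (n + m) (c.fibM_ne (n + m) y)
    simp only [hG]
    rw [← Real.log_mul h1.ne' h2.ne']
    exact Real.log_le_log h3 (c.Rsup_add n m y)
  have hGm : ∀ n, Measurable (G n) := fun n => (Rsup_fibM_cont n n).measurable.log
  have hN' : (0 : ℝ) < N := by exact_mod_cast hN
  set h : Y → ℝ := fun y => (1 / (N : ℝ)) * G N y with hh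
  have hhm : Measurable h := (hGm N).const_mul _
  have hhC : ∀ y, |h y| ≤ C := fun y => avg_abs_le (hGC N y) hC0
  have key : ∀ n y, G (n + N) y ≤ birk σY h n y + 2 * N * C := by
    intro n y
    have h1 : ∑ t ∈ Finset.range n, (G (t + N) y - G t y) ≤ N * birk σY h n y := by
      unfold birk
      rw [Finset.mul_sum]
      refine Finset.sum_le_sum fun t _ => ?_
      have := hGadd t N y
      simp only [hh]
      rw [← mul_assoc, mul_one_div_cancel hN'.ne', one_mul]
      linarith
    have h2 : ∑ t ∈ Finset.range n, (G (t + N) y - G t y) =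
        ∑ s ∈ Finset.range N, (G (n + s) y - G s y) := by
      rw [Finset.sum_sub_distrib, Finset.sum_sub_distrib]
      have e1 := Finset.sum_range_add (fun t => G t y) n N
      have e2 := Finset.sum_range_add (fun t => G t y) N n
      rw [add_comm N n] at e2
      have e3 : ∑ t ∈ Finset.range n, G (t + N) y = ∑ t ∈ Finset.range n, G (N + t) y :=
        Finset.sum_congr rfl fun t _ => by rw [add_comm]
      rw [e3]
      linarith
    have h3 : ∑ s ∈ Finset.range N, (G (n + N) y - 2 * N * C) ≤
        ∑ s ∈ Finset.range N, (G (n + s) y - G s y) := by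
      refine Finset.sum_le_sum fun s hs => ?_
      have hsN : s ≤ N := (Finset.mem_range.1 hs).le
      have a := hGadd (n + s) (N - s) y
      rw [show n + s + (N - s) = n + N by omega] at a
      have b := (abs_le.1 (hGC (N - s) (σY^[n + s] y))).2
      have d := (abs_le.1 (hGC s y)).2
      have e : ((N - s : ℕ) : ℝ) * C ≤ N * C := by
        gcongr; omega
      have e' : (s : ℝ) * C ≤ N * C := by gcongr
      linarith
    simp only [Finset.sum_const, Finset.card_range, nsmul_eq_mul] at h3
    have h4 : N * (G (n + N) y - 2 * N * C) ≤ N * birk σY h n y := by linarith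
    have := le_of_mul_le_mul_left h4 hN'
    linarith
  have hle : ∀ y, Ufun σX π f y ≤
      limsup (fun n : ℕ => (1 / (n : ℝ)) * birk σY h n y) atTop := by
    intro y
    refine limsup_le_limsup_add (e := fun n : ℕ => 3 * N * C / n)
      (fun n => avg_abs_le (birk_abs_le σY h C hhC n y) hC0) (fun n => c.avgU n n y)
      (tendsto_const_div_atTop_nhds_zero_nat _) ?_
    filter_upwards [eventually_ge_atTop N] with n hn
    obtain ⟨j, rfl⟩ : ∃ j, n = j + N := ⟨n - N, by omega⟩
    rw [one_div_mul_eq_div, one_div_mul_eq_div, ← add_div]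
    have a := key j y
    have b := birk_add σY h j N y
    have d := (abs_le.1 (birk_abs_le σY h C hhC N (σY^[j] y))).1
    gcongr
    change G (j + N) y ≤ _
    linarith
  have hUm : Measurable (Ufun σX π f : Y → ℝ) :=
    Measurable.limsup fun n => (hGm n).const_mul _
  have hUi : Integrable (Ufun σX π f : Y → ℝ) ν :=
    Integrable.of_bound hUm.aestronglyMeasurable C
      (Eventually.of_forall fun y => limsup_abs_le fun n => c.avgU n n y)
  have hBi : Integrable (fun y => limsup (fun n : ℕ => (1 / (n : ℝ)) * birk σY h n y) atTop) ν := by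
    refine Integrable.of_bound (Measurable.aestronglyMeasurable (Measurable.limsup fun n =>
      (birk_measurable hν.measurable hhm n).const_mul _)) C (Eventually.of_forall fun y => ?_)
    exact limsup_abs_le fun n => avg_abs_le (birk_abs_le σY h C hhC n y) hC0
  refine (integral_mono hUi hBi hle).trans ((birkhoff_limsup ν σY hν h hhm C hhC).trans ?_)
  rw [← integral_const_mul]

end Factor

/-! ### Upper bound for all lifts -/

lemma ent_rel {Ω α β γ δ : Type*} [MeasurableSpace Ω] [Fintype α] [Fintype β] [Fintype γ]
    [Fintype δ] [MeasurableSpace α] [MeasurableSingletonClass α] [MeasurableSpace β]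
    [MeasurableSingletonClass β] [MeasurableSpace γ] [MeasurableSingletonClass γ]
    [MeasurableSpace δ] [MeasurableSingletonClass δ]
    (μ : Measure Ω) [IsProbabilityMeasure μ] {A : Ω → α} {B : Ω → β} {V : Ω → γ} {D : Ω → δ}
    (hA : Measurable A) (hB : Measurable B) (hV : Measurable V) (hD : Measurable D)
    (g : β → δ) (h : γ → δ) (hg : ∀ x, g (B x) = D x) (hh : ∀ x, h (V x) = D x)
    (w : α → γ → ℝ) (hw0 : ∀ a v, 0 ≤ w a v) (hw1 : ∀ v, ∑ a, w a v ≤ 1)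
    (hwpos : ∀ x, 0 < w (A x) (V x)) :
    ent μ (fun x => (A x, B x)) ≤
      ent μ B + ent μ V - ent μ D - ∫ x, Real.log (w (A x) (V x)) ∂μ := by
  classical
  have hT : Measurable (fun x => (A x, B x, V x)) := hA.prodMk (hB.prodMk hV)
  have h1 := ent_comp_le μ hT (fun p : α × β × γ => (p.1, p.2.1))
  refine h1.trans ?_
  let pB : β → ℝ := fun b => μ.real (B ⁻¹' {b})
  let pV : γ → ℝ := fun b => μ.real (V ⁻¹' {b})
  let pD : δ → ℝ := fun b => μ.real (D ⁻¹' {b})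
  have hpD : ∀ d, pD d = ∑ v with h v = d, pV v := by
    intro d
    have := law_comp μ hV h d
    rw [← this]
    simp only [pD]
    congr 2
    ext x
    exact (hh x).symm
  let q : α × β × γ → ℝ := fun p =>
    if h p.2.2 = g p.2.1 then pB p.2.1 * (pV p.2.2 / pD (g p.2.1)) * w p.1 p.2.2 else 0
  have hB0 : ∀ b, 0 ≤ pB b := fun _ => measureReal_nonneg
  have hV0 : ∀ b, 0 ≤ pV b := fun _ => measureReal_nonneg
  have hD0 : ∀ b, 0 ≤ pD b := fun _ => measureReal_nonneg
  have hq0 : ∀ p, 0 ≤ q p := by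
    intro p
    simp only [q]
    split_ifs
    · exact mul_nonneg (mul_nonneg (hB0 _) (div_nonneg (hV0 _) (hD0 _))) (hw0 _ _)
    · exact le_rfl
  have hq1 : ∑ p, q p ≤ 1 := by
    rw [Fintype.sum_prod_type, Finset.sum_comm, Fintype.sum_prod_type]
    rw [← sum_law μ hB]
    refine Finset.sum_le_sum fun b _ => ?_
    have e1 : ∀ v, ∑ a, q (a, b, v) ≤ if h v = g b then pB b * (pV v / pD (g b)) else 0 := by
      intro v
      simp only [q]
      split_ifs
      · rw [← Finset.mul_sum]
        exact mul_le_of_le_one_right (mul_nonneg (hB0 _) (div_nonneg (hV0 _) (hD0 _))) (hw1 v)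
      · simp
    refine (Finset.sum_le_sum fun v _ => e1 v).trans ?_
    rw [← Finset.sum_filter, ← Finset.mul_sum, ← Finset.sum_div, ← hpD]
    exact mul_le_of_le_one_right (hB0 b) (div_self_le_one _)
  have hpos : ∀ x, μ.real ((fun x => (A x, B x, V x)) ⁻¹' {(A x, B x, V x)}) ≠ 0 →
      0 < pB (B x) ∧ 0 < pV (V x) ∧ 0 < pD (D x) := by
    intro x hx
    refine ⟨real_preimage_mono_pos μ ?_ hx, real_preimage_mono_pos μ ?_ hx,
      real_preimage_mono_pos μ ?_ hx⟩
    · intro z hz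
      simp only [Set.mem_preimage, Set.mem_singleton_iff, Prod.mk.injEq] at hz ⊢
      exact hz.2.1
    · intro z hz
      simp only [Set.mem_preimage, Set.mem_singleton_iff, Prod.mk.injEq] at hz ⊢
      exact hz.2.2
    · intro z hz
      simp only [Set.mem_preimage, Set.mem_singleton_iff, Prod.mk.injEq] at hz ⊢
      rw [← hh, ← hh, hz.2.2]
  have hG := gibbs μ hT q hq0 hq1 (by
    intro p hp
    by_cases hne : ∃ x, (A x, B x, V x) = p
    · obtain ⟨x, rfl⟩ := hne
      obtain ⟨a1, a2, a3⟩ := hpos x hp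
      simp only [q]
      rw [if_pos (by rw [hh, hg]), hg]
      exact mul_pos (mul_pos a1 (div_pos a2 a3)) (hwpos x)
    · exfalso
      apply hp
      have : (fun x => (A x, B x, V x)) ⁻¹' {p} = ∅ := by
        ext x
        simp only [Set.mem_preimage, Set.mem_singleton_iff, Set.mem_empty_iff_false, iff_false]
        exact fun hx => hne ⟨x, hx⟩
      rw [this]; simp)
  refine hG.trans (le_of_eq ?_)
  have hae : ∀ᵐ x ∂μ, Real.log (q (A x, B x, V x)) =
      Real.log (pB (B x)) + Real.log (pV (V x)) - Real.log (pD (D x))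
        + Real.log (w (A x) (V x)) := by
    have hnz : ∀ᵐ x ∂μ, μ.real ((fun x => (A x, B x, V x)) ⁻¹' {(A x, B x, V x)}) ≠ 0 := by
      rw [ae_iff]
      have : {x | ¬ μ.real ((fun x => (A x, B x, V x)) ⁻¹' {(A x, B x, V x)}) ≠ 0} ⊆
          ⋃ p ∈ {p : α × β × γ | μ ((fun x => (A x, B x, V x)) ⁻¹' {p}) = 0},
            (fun x => (A x, B x, V x)) ⁻¹' {p} := by
        intro x hx
        have hx' : μ.real ((fun x => (A x, B x, V x)) ⁻¹' {(A x, B x, V x)}) = 0 := not_not.1 hx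
        simp only [Set.mem_iUnion]
        refine ⟨(A x, B x, V x), ?_, rfl⟩
        exact (measureReal_eq_zero_iff).1 hx'
      refine measure_mono_null this ?_
      rw [measure_biUnion_null_iff (Set.to_countable _)]
      exact fun p hp => hp
    filter_upwards [hnz] with x hx
    obtain ⟨a1, a2, a3⟩ := hpos x hx
    simp only [q]
    rw [if_pos (by rw [hh, hg]), hg, Real.log_mul (mul_pos a1 (div_pos a2 a3)).ne' (hwpos x).ne',
      Real.log_mul a1.ne' (div_pos a2 a3).ne', Real.log_div a2.ne' a3.ne']
    ring
  have i1 : Integrable (fun x => Real.log (pB (B x))) μ :=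
    integrable_fin μ hB fun b => Real.log (pB b)
  have i2 : Integrable (fun x => Real.log (pV (V x))) μ :=
    integrable_fin μ hV fun b => Real.log (pV b)
  have i3 : Integrable (fun x => Real.log (pD (D x))) μ :=
    integrable_fin μ hD fun b => Real.log (pD b)
  have i4 : Integrable (fun x => Real.log (w (A x) (V x))) μ :=
    integrable_fin μ hT fun p => Real.log (w p.1 p.2.2)
  have i12 : Integrable (fun x => Real.log (pB (B x)) + Real.log (pV (V x))) μ := i1.add i2
  have i123 : Integrable
      (fun x => Real.log (pB (B x)) + Real.log (pV (V x)) - Real.log (pD (D x))) μ := i12.sub i3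
  rw [integral_congr_ae hae, integral_add i123 i4, integral_sub i12 i3, integral_add i1 i2,
    ent_eq_integral μ hB, ent_eq_integral μ hV, ent_eq_integral μ hD]
  ring

section Upper

variable {k l : ℕ} {X : Set (ℕ → Fin k)} {Y : Set (ℕ → Fin l)} {σX : X → X} {σY : Y → Y}
    {π : X → Y} {τ : Fin k → Fin l} {f : X → ℝ} {M : ℝ}

lemma FCtx.map_inv (c : FCtx X Y σX σY π τ f M) (μ : Measure X)
    (hμ : MeasurePreserving σX μ μ) : MeasurePreserving σY (μ.map π) (μ.map π) := by
  have hπm := c.hπc.measurable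
  refine ⟨(shift_cont c.hσY).measurable, ?_⟩
  rw [Measure.map_map (shift_cont c.hσY).measurable hπm]
  have : σY ∘ π = π ∘ σX := funext fun x => (c.hcomm x).symm
  rw [this, ← Measure.map_map hπm hμ.measurable, hμ.map_eq]

lemma FCtx.f_int (c : FCtx X Y σX σY π τ f M) (μ : Measure X) [IsProbabilityMeasure μ] :
    Integrable f μ :=
  Integrable.of_bound c.hf.measurable.aestronglyMeasurable M (Eventually.of_forall c.hM)

lemma FCtx.ent_step (c : FCtx X Y σX σY π τ f M) (μ : Measure X) [IsProbabilityMeasure μ]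
    (hμ : MeasurePreserving σX μ μ) (n r : ℕ) :
    ent μ (wd X (n + r)) + n * ∫ x, f x ∂μ ≤
      ent μ (wd X r) + ent (μ.map π) (wd Y (n + r)) - ent (μ.map π) (wd Y r)
        + ∫ y, Real.log (Rsup σX f n (fibM π (n + r) y)) ∂(μ.map π) := by
  have hπm := c.hπc.measurable
  have hσm : Measurable σX := hμ.measurable
  have hνp : IsProbabilityMeasure (μ.map π) := Measure.isProbabilityMeasure_map hπm.aemeasurable
  have hν := c.map_inv μ hμ
  let S : (Fin (n + r) → Fin l) → Set X := fun v => {x | wd Y (n + r) (π x) = v}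
  let w : (Fin n → Fin k) → (Fin (n + r) → Fin l) → ℝ := fun a v =>
    esup σX f n a (S v) / Rsup σX f n (S v)
  have hxS : ∀ x, x ∈ S (wd Y (n + r) (π x)) := fun x => rfl
  have hE : ∀ x, Real.exp (birk σX f n x) ≤
      esup σX f n (wd X n x) (S (wd Y (n + r) (π x))) := fun x => le_esup c.hM (hxS x)
  have hR : ∀ x, 0 < Rsup σX f n (S (wd Y (n + r) (π x))) := fun x => Rsup_pos c.hM n ⟨x, hxS x⟩
  have hR0 : ∀ v, 0 ≤ Rsup σX f n (S v) := fun v =>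
    Finset.sum_nonneg fun u _ => esup_nonneg n u _
  have hVm : Measurable (fun x => wd Y (n + r) (π x)) := (wd_meas _).comp hπm
  have hDm : Measurable (fun x => wd Y r (π (σX^[n] x))) :=
    (wd_meas _).comp (hπm.comp (hσm.iterate n))
  have hrel := ent_rel μ (wd_meas (X := X) n) ((wd_meas (X := X) r).comp (hσm.iterate n)) hVm hDm
    (fun b i => τ (b i)) (fun v => (splitW n r v).2)
    (fun x => by funext i; exact (c.hτ _ _).symm)
    (fun x => by rw [split_wd c.hσY, c.comm_iter]) w
    (fun a v => div_nonneg (esup_nonneg _ _ _) (hR0 v))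
    (fun v => by
      simp only [w]
      rw [← Finset.sum_div]
      exact div_self_le_one _)
    (fun x => div_pos ((Real.exp_pos _).trans_le (hE x)) (hR x))
  rw [ent_wd_pair c.hσX]
  have e1 : ent μ (wd X r ∘ σX^[n]) = ent μ (wd X r) := ent_wd_inv c.hσX μ hμ n r
  have e2 : ent μ (fun x => wd Y (n + r) (π x)) = ent (μ.map π) (wd Y (n + r)) :=
    (ent_map μ hπm (wd_meas _)).symm
  have e3 : ent μ (fun x => wd Y r (π (σX^[n] x))) = ent (μ.map π) (wd Y r) := by
    have e := ent_map μ hπm ((wd_meas r).comp (hν.measurable.iterate n))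
    have e' : ent (μ.map π) (wd Y r ∘ σY^[n]) = ent (μ.map π) (wd Y r) :=
      ent_wd_inv c.hσY (μ.map π) hν n r
    rw [← e', e]
    simp only [c.comm_iter, Function.comp]
  rw [e1, e2, e3] at hrel
  have e4 : ∫ y, Real.log (Rsup σX f n (fibM π (n + r) y)) ∂(μ.map π) =
      ∫ x, Real.log (Rsup σX f n (S (wd Y (n + r) (π x)))) ∂μ := by
    rw [integral_map hπm.aemeasurable
      ((Rsup_fibM_cont n (n + r)).measurable.log).aestronglyMeasurable]
    rfl
  have i1 : Integrable (fun x => Real.log (Rsup σX f n (S (wd Y (n + r) (π x))))) μ :=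
    integrable_fin μ hVm fun v => Real.log (Rsup σX f n (S v))
  have i2 : Integrable (fun x => birk σX f n x) μ :=
    Integrable.of_bound (birk_measurable hσm c.hf.measurable n).aestronglyMeasurable (n * M)
      (Eventually.of_forall fun x => birk_abs_le σX f M c.hM n x)
  have i3 : Integrable (fun x => Real.log (w (wd X n x) (wd Y (n + r) (π x)))) μ :=
    integrable_fin μ ((wd_meas n).prodMk hVm) fun p => Real.log (w p.1 p.2)
  have e5 : n * ∫ x, f x ∂μ - ∫ x, Real.log (Rsup σX f n (S (wd Y (n + r) (π x)))) ∂μ ≤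
      ∫ x, Real.log (w (wd X n x) (wd Y (n + r) (π x))) ∂μ := by
    rw [← birk_integral hμ c.hf.measurable (c.f_int μ) n, ← integral_sub i2 i1]
    refine integral_mono (i2.sub i1) i3 fun x => ?_
    simp only [w]
    rw [Real.log_div ((Real.exp_pos _).trans_le (hE x)).ne' (hR x).ne']
    have := Real.log_le_log (Real.exp_pos _) (hE x)
    rw [Real.log_exp] at this
    linarith
  rw [e4]
  have hrel' : ent μ (fun x => (wd X n x, wd X r (σX^[n] x))) ≤ _ := hrel
  linarith

lemma FCtx.int_step (c : FCtx X Y σX σY π τ f M) (μ : Measure X) [IsProbabilityMeasure μ]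
    (hμ : MeasurePreserving σX μ μ) (n : ℕ) (hn : 1 ≤ n) :
    n * (mEntropy X μ - mEntropy Y (μ.map π)) + n * ∫ x, f x ∂μ ≤
      ∫ y, Real.log (Rsup σX f n (fibI π y)) ∂(μ.map π) := by
  have hπm := c.hπc.measurable
  have hνp : IsProbabilityMeasure (μ.map π) := Measure.isProbabilityMeasure_map hπm.aemeasurable
  have hν := c.map_inv μ hμ
  set d : ℕ → ℝ := fun j => ent μ (wd X (j * n)) - ent (μ.map π) (wd Y (j * n)) with hd
  set I : ℕ → ℝ := fun j => ∫ y, Real.log (Rsup σX f n (fibM π (n + j * n) y)) ∂(μ.map π) with hI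
  have hstep : ∀ j, d (j + 1) - d j + n * ∫ x, f x ∂μ ≤ I j := by
    intro j
    have := c.ent_step μ hμ n (j * n)
    have e : (j + 1) * n = n + j * n := by ring
    simp only [hd, hI]
    rw [e]
    linarith
  have hIlim : Tendsto I atTop (𝓝 (∫ y, Real.log (Rsup σX f n (fibI π y)) ∂(μ.map π))) := by
    refine tendsto_integral_of_dominated_convergence (fun _ => n * (M + Real.log k))
      (fun j => ((Rsup_fibM_cont n _).measurable.log).aestronglyMeasurable)
      (integrable_const _) (fun j => Eventually.of_forall fun y =>
        Rsup_log c.hM n (c.fibM_ne _ y)) (Eventually.of_forall fun y => ?_)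
    have h1 : Tendsto (fun j => n + j * n) atTop atTop :=
      tendsto_atTop_mono (fun j => by simp only [id]; nlinarith) tendsto_id
    exact ((c.Rsup_tendsto n y).comp h1).log (Rsup_pos c.hM n (c.fibI_ne y)).ne'
  have hces := hIlim.cesaro
  have hsum : ∀ J : ℕ, d J - d 0 + J * (n * ∫ x, f x ∂μ) ≤ ∑ j ∈ Finset.range J, I j := by
    intro J
    induction J with
    | zero => simp
    | succ J ih =>
      rw [Finset.sum_range_succ]
      have := hstep J
      push_cast
      linarith
  have hn0 : (n : ℝ) ≠ 0 := by positivity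
  have hjn : Tendsto (fun j : ℕ => j * n) atTop atTop :=
    tendsto_atTop_mono (fun j => by simp only [id]; nlinarith) tendsto_id
  have h1 := ((mEntropy_tendsto c.hσX μ hμ).comp hjn).sub
    ((mEntropy_tendsto c.hσY (μ.map π) hν).comp hjn)
  have h2 : Tendsto (fun J : ℕ => d J / J) atTop
      (𝓝 (n * (mEntropy X μ - mEntropy Y (μ.map π)))) := by
    refine (h1.const_mul (n : ℝ)).congr fun J => ?_
    simp only [Function.comp, hd]
    push_cast
    by_cases hJ : (J : ℝ) = 0
    · simp [hJ]
    · field_simp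
  have h3 := (h2.sub (tendsto_const_div_atTop_nhds_zero_nat (d 0))).add_const (n * ∫ x, f x ∂μ)
  rw [sub_zero] at h3
  refine le_of_tendsto_of_tendsto h3 hces ?_
  filter_upwards [eventually_ge_atTop 1] with J hJ
  have hJ0 : (0 : ℝ) < J := by exact_mod_cast hJ
  have := mul_le_mul_of_nonneg_left (hsum J) (inv_pos.2 hJ0).le
  refine le_trans (le_of_eq ?_) this
  field_simp

lemma FCtx.upper (c : FCtx X Y σX σY π τ f M) (μ : Measure X) [IsProbabilityMeasure μ]
    (hμ : MeasurePreserving σX μ μ) :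
    mEntropy X μ + ∫ x, f x ∂μ ≤ mEntropy Y (μ.map π) + ∫ y, Lfun σX π f y ∂(μ.map π) := by
  have hνp : IsProbabilityMeasure (μ.map π) :=
    Measure.isProbabilityMeasure_map c.hπc.measurable.aemeasurable
  have := reverse_fatou (μ.map π)
    (fun n y => (1 / (n : ℝ)) * Real.log (Rsup σX f n (fibI π y)))
    (fun n => (c.Rsup_fibI_meas n).log.const_mul _) (M + Real.log k) c.avgI
    (mEntropy X μ - mEntropy Y (μ.map π) + ∫ x, f x ∂μ) (by
      intro n hn
      have h := c.int_step μ hμ n hn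
      have hn0 : (0 : ℝ) < n := by exact_mod_cast hn
      rw [integral_const_mul, one_div, ← div_eq_inv_mul, le_div_iff₀ hn0]
      linarith)
  have h' : _ ≤ ∫ y, Lfun σX π f y ∂(μ.map π) := this
  linarith

end Upper

/-! ### Existence of a good lift -/

section Lower

variable {k l : ℕ} {X : Set (ℕ → Fin k)} {Y : Set (ℕ → Fin l)} {σX : X → X} {σY : Y → Y}
    {π : X → Y} {τ : Fin k → Fin l} {f : X → ℝ} {M : ℝ}

lemma FCtx.exists_lam (c : FCtx X Y σX σY π τ f M) (ν : Measure Y) [IsProbabilityMeasure ν]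
    (n : ℕ) : ∃ lam : Measure X, IsProbabilityMeasure lam ∧
      (∀ v, lam.real ((fun x => wd Y n (π x)) ⁻¹' {v}) = ν.real (wd Y n ⁻¹' {v})) ∧
      ent lam (wd X n) + ∫ x, birk σX f n x ∂lam =
        ent ν (wd Y n) + ∫ y, Real.log (Rsup σX f n (fibM π n y)) ∂ν := by
  classical
  obtain ⟨y0⟩ : Nonempty Y := nonempty_of_isProbabilityMeasure ν
  obtain ⟨x0, -⟩ := c.hπs y0
  have hπm := c.hπc.measurable
  let S : (Fin n → Fin l) → Set X := fun v => {x | wd Y n (π x) = v}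
  let g : (Fin n → Fin k) → (Fin n → Fin l) := fun u i => τ (u i)
  have hg : ∀ x, wd Y n (π x) = g (wd X n x) := fun x => funext fun i => c.hτ x i
  have hSc : ∀ v, IsClosed (S v) := fun v => (cyl_clopen n v).1.preimage c.hπc
  have hempty : ∀ u v, g u ≠ v → esup σX f n u (S v) = 0 := by
    intro u v huv
    have : wd X n ⁻¹' {u} ∩ S v = ∅ := by
      ext x
      simp only [Set.mem_inter_iff, Set.mem_preimage, Set.mem_singleton_iff,
        Set.mem_empty_iff_false, iff_false, not_and]
      intro hx hx'
      have hx'' : wd Y n (π x) = v := hx'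
      rw [hg, hx] at hx''
      exact huv hx''
    rw [esup, this, Set.image_empty, Real.sSup_empty]
  let e : (Fin n → Fin k) → ℝ := fun u => esup σX f n u (S (g u))
  let R : (Fin n → Fin l) → ℝ := fun v => Rsup σX f n (S v)
  let p : (Fin n → Fin l) → ℝ := fun v => ν.real (wd Y n ⁻¹' {v})
  have he0 : ∀ u, 0 ≤ e u := fun u => esup_nonneg _ _ _
  have hR0 : ∀ v, 0 ≤ R v := fun v => Finset.sum_nonneg fun u _ => esup_nonneg _ _ _
  have hp0 : ∀ v, 0 ≤ p v := fun v => measureReal_nonneg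
  have hRe : ∀ v, ∑ u with g u = v, e u = R v := by
    intro v
    rw [Finset.sum_filter]
    refine Finset.sum_congr rfl fun u _ => ?_
    split_ifs with h
    · simp only [e, h]
    · exact (hempty u v h).symm
  have hRpos : ∀ v, p v ≠ 0 → 0 < R v := by
    intro v hv
    have : (wd Y n ⁻¹' {v}).Nonempty := by
      by_contra hcon
      rw [Set.not_nonempty_iff_eq_empty] at hcon
      exact hv (by simp only [p]; rw [hcon]; simp)
    obtain ⟨y, hy⟩ := this
    obtain ⟨x, rfl⟩ := c.hπs y
    exact Rsup_pos c.hM n ⟨x, hy⟩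
  have hpt : ∀ u, ∃ x : X, e u ≠ 0 → wd X n x = u ∧ Real.log (e u) = birk σX f n x := by
    intro u
    by_cases hne : (wd X n ⁻¹' {u} ∩ S (g u)).Nonempty
    · obtain ⟨x, -, hx1, hx2⟩ := esup_attained c.hX (shift_cont c.hσX) c.hf (hSc _) hne
      refine ⟨x, fun _ => ⟨hx1, ?_⟩⟩
      simp only [e]
      rw [hx2, Real.log_exp]
    · refine ⟨x0, fun h => absurd ?_ h⟩
      rw [Set.not_nonempty_iff_eq_empty] at hne
      simp only [e]
      rw [esup, hne, Set.image_empty, Real.sSup_empty]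
  choose pt hpt using hpt
  let w : (Fin n → Fin k) → ℝ := fun u => p (g u) * (e u / R (g u))
  have hw0 : ∀ u, 0 ≤ w u := fun u => mul_nonneg (hp0 _) (div_nonneg (he0 _) (hR0 _))
  have hwv : ∀ v, ∑ u with g u = v, w u = p v := by
    intro v
    have : ∑ u with g u = v, w u = ∑ u with g u = v, p v * (e u / R v) := by
      refine Finset.sum_congr rfl fun u hu => ?_
      rw [Finset.mem_filter] at hu
      simp only [w, hu.2]
    rw [this, ← Finset.mul_sum, ← Finset.sum_div, hRe]
    by_cases hv : p v = 0
    · rw [hv, zero_mul]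
    · rw [div_self (hRpos v hv).ne', mul_one]
  have hgroup : ∀ φ : (Fin n → Fin l) → ℝ, ∑ u, w u * φ (g u) = ∑ v, p v * φ v := by
    intro φ
    rw [← Finset.sum_fiberwise Finset.univ g]
    refine Finset.sum_congr rfl fun v _ => ?_
    rw [← hwv v, Finset.sum_mul]
    refine Finset.sum_congr rfl fun u hu => ?_
    rw [Finset.mem_filter] at hu
    rw [hu.2]
  have hw1 : ∑ u, w u = 1 := by
    have := hgroup (fun _ => 1)
    simp only [mul_one] at this
    rw [this]
    exact sum_law ν (wd_meas n)
  let lam : Measure X := ∑ u, ENNReal.ofReal (w u) • Measure.dirac (pt u)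
  have hlamP : IsProbabilityMeasure lam := by
    constructor
    simp only [lam, Measure.finsetSum_apply, Measure.smul_apply, measure_univ, smul_eq_mul, mul_one]
    rw [← ENNReal.ofReal_sum_of_nonneg fun u _ => hw0 u, hw1, ENNReal.ofReal_one]
  have hInt : ∀ φ : X → ℝ, Measurable φ → ∫ x, φ x ∂lam = ∑ u, w u * φ (pt u) := by
    intro φ hφ
    have hi : ∀ u ∈ (Finset.univ : Finset (Fin n → Fin k)),
        Integrable φ (ENNReal.ofReal (w u) • Measure.dirac (pt u)) := fun u _ =>
      (integrable_dirac (by simp [enorm_lt_top])).smul_measure ENNReal.ofReal_ne_top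
    simp only [lam]
    rw [integral_finsetSum_measure hi]
    refine Finset.sum_congr rfl fun u _ => ?_
    rw [integral_smul_measure, integral_dirac, ENNReal.toReal_ofReal (hw0 u), smul_eq_mul]
  have hwpt : ∀ u, w u ≠ 0 → wd X n (pt u) = u ∧ Real.log (e u) = birk σX f n (pt u) := by
    intro u hu
    refine hpt u fun h => hu ?_
    simp only [w, h]; simp
  have hlaw : ∀ u, lam.real (wd X n ⁻¹' {u}) = w u := by
    intro u
    have h1 := hInt ((wd X n ⁻¹' {u}).indicator 1)
      (measurable_one.indicator (wd_meas n (measurableSet_singleton u)))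
    rw [integral_indicator_one (wd_meas n (measurableSet_singleton u))] at h1
    rw [h1, Finset.sum_eq_single u]
    · by_cases hu : w u = 0
      · rw [hu, zero_mul]
      · have hmem : pt u ∈ wd X n ⁻¹' {u} := (hwpt u hu).1
        rw [Set.indicator_of_mem hmem]; simp
    · intro u' _ hne
      by_cases hu : w u' = 0
      · rw [hu, zero_mul]
      · rw [Set.indicator_of_notMem, mul_zero]
        intro hmem
        have hmem' : wd X n (pt u') = u := hmem
        rw [(hwpt u' hu).1] at hmem'
        exact hne hmem'
    · intro h; exact absurd (Finset.mem_univ u) h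
  refine ⟨lam, hlamP, ?_, ?_⟩
  · intro v
    have := law_comp lam (wd_meas (X := X) n) g v
    simp only [hg]
    rw [this]
    simp only [hlaw]
    exact hwv v
  · have e1 : ∫ y, Real.log (Rsup σX f n (fibM π n y)) ∂ν = ∑ v, p v * Real.log (R v) :=
      integral_fin ν (wd_meas (X := Y) n) fun v => Real.log (R v)
    have e2 : ent ν (wd Y n) = - ∑ v, p v * Real.log (p v) := by
      rw [ent, ← Finset.sum_neg_distrib]
      refine Finset.sum_congr rfl fun v _ => ?_
      rw [Real.negMulLog, neg_mul]
    have e3 : ent lam (wd X n) = - ∑ u, w u * Real.log (w u) := by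
      rw [ent, ← Finset.sum_neg_distrib]
      refine Finset.sum_congr rfl fun v _ => ?_
      rw [hlaw, Real.negMulLog, neg_mul]
    rw [e1, e2, e3, hInt _ (birk_cont (shift_cont c.hσX) c.hf n).measurable,
      ← hgroup fun v => Real.log (R v), ← hgroup fun v => Real.log (p v),
      ← Finset.sum_neg_distrib, ← Finset.sum_neg_distrib, ← Finset.sum_add_distrib,
      ← Finset.sum_add_distrib]
    refine Finset.sum_congr rfl fun u _ => ?_
    by_cases hu : w u = 0
    · simp [hu]
    · have hpu : p (g u) ≠ 0 := fun h => hu (by simp only [w, h]; simp)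
      have heu : e u ≠ 0 := fun h => hu (by simp only [w, h]; simp)
      have hRu : R (g u) ≠ 0 := (hRpos _ hpu).ne'
      have : Real.log (w u) = Real.log (p (g u)) + (Real.log (e u) - Real.log (R (g u))) := by
        simp only [w]
        rw [Real.log_mul hpu (div_ne_zero heu hRu), Real.log_div heu hRu]
      rw [this, (hwpt u hu).2]
      ring

lemma avgM_shift {Ω : Type*} [MeasurableSpace Ω] {T : Ω → Ω} (hT : Measurable T) (lam : Measure Ω)
    [IsProbabilityMeasure lam] (n : ℕ) (s : Set Ω) (hs : MeasurableSet s) :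
    |(avgM T lam n).real (T ⁻¹' s) - (avgM T lam n).real s| ≤ 1 / n := by
  rw [avgM_real hT lam _ (hT hs), avgM_real hT lam _ hs, ← mul_sub, ← Finset.sum_sub_distrib]
  have : ∀ i, lam.real (T^[i] ⁻¹' (T ⁻¹' s)) = lam.real (T^[i + 1] ⁻¹' s) := by
    intro i
    rw [← Set.preimage_comp, ← Function.iterate_succ']
  simp only [this]
  rw [Finset.sum_range_sub fun i => lam.real (T^[i] ⁻¹' s), abs_mul, abs_of_nonneg (by positivity)]
  refine mul_le_of_le_one_right (by positivity) ?_
  have a1 : 0 ≤ lam.real (T^[n] ⁻¹' s) := measureReal_nonneg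
  have a2 : lam.real (T^[n] ⁻¹' s) ≤ 1 := measureReal_le_one
  have a3 : 0 ≤ lam.real (T^[0] ⁻¹' s) := measureReal_nonneg
  have a4 : lam.real (T^[0] ⁻¹' s) ≤ 1 := measureReal_le_one
  rw [abs_le]
  constructor <;> linarith

lemma FCtx.avg_law (c : FCtx X Y σX σY π τ f M) (ν : Measure Y) [IsProbabilityMeasure ν]
    (hν : MeasurePreserving σY ν ν) (n : ℕ) (lam : Measure X) [IsProbabilityMeasure lam]
    (hlam : ∀ v, lam.real ((fun x => wd Y n (π x)) ⁻¹' {v}) = ν.real (wd Y n ⁻¹' {v}))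
    (m : ℕ) (v : Fin m → Fin l) (hn : 1 ≤ n) :
    |(avgM σX lam n).real ((fun x => wd Y m (π x)) ⁻¹' {v}) - ν.real (wd Y m ⁻¹' {v})| ≤ m / n := by
  classical
  have hπm := c.hπc.measurable
  have hσm := (shift_cont c.hσX).measurable
  have hn0 : (0 : ℝ) < n := by exact_mod_cast hn
  have hVm : Measurable (fun x => wd Y m (π x)) := (wd_meas m).comp hπm
  rw [avgM_real hσm lam _ (hVm (measurableSet_singleton v))]
  set b := ν.real (wd Y m ⁻¹' {v}) with hb
  have hb0 : 0 ≤ b := measureReal_nonneg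
  have hb1 : b ≤ 1 := measureReal_le_one
  set a : ℕ → ℝ := fun i => lam.real (σX^[i] ⁻¹' ((fun x => wd Y m (π x)) ⁻¹' {v})) with ha
  have hab : ∀ i, i + m ≤ n → a i = b := by
    intro i hi
    let G : (Fin n → Fin l) → (Fin m → Fin l) := fun w j => w ⟨i + j, by omega⟩
    have hG : ∀ y : Y, G (wd Y n y) = wd Y m (σY^[i] y) := by
      intro y
      funext j
      simp only [G, wd]
      rw [iter_apply c.hσY, add_comm]
    have h1 := law_comp lam ((wd_meas n).comp hπm) G v
    have h2 := law_comp ν (wd_meas (X := Y) n) G v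
    have h3 : a i = lam.real ((fun x => G ((wd Y n ∘ π) x)) ⁻¹' {v}) := by
      simp only [ha]
      congr 1
      ext x
      simp only [Set.mem_preimage, Set.mem_singleton_iff, Function.comp]
      rw [hG, c.comm_iter]
    have h4 : b = ν.real ((fun y => G (wd Y n y)) ⁻¹' {v}) := by
      have := (hν.iterate i).measureReal_preimage
        ((wd_meas m (measurableSet_singleton v)).nullMeasurableSet)
      rw [hb, ← this]
      congr 1
      ext y
      simp only [Set.mem_preimage, Set.mem_singleton_iff]
      rw [hG]
    rw [h3, h4, h1, h2]
    exact Finset.sum_congr rfl fun w _ => hlam w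
  have hle : ∀ i, |a i - b| ≤ if n < i + m then 1 else 0 := by
    intro i
    split_ifs with h
    · have a1 : 0 ≤ a i := measureReal_nonneg
      have a2 : a i ≤ 1 := measureReal_le_one
      rw [abs_le]
      constructor <;> linarith
    · rw [hab i (by omega)]; simp
  have hcard : (∑ i ∈ Finset.range n, if n < i + m then (1 : ℝ) else 0) ≤ m := by
    rw [Finset.sum_boole]
    have h1 : (Finset.range n).filter (fun i => n < i + m) ⊆ Finset.Ico (n - m) n := by
      intro i hi
      simp only [Finset.mem_filter, Finset.mem_range, Finset.mem_Ico] at hi ⊢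
      omega
    have h2 := Finset.card_le_card h1
    rw [Nat.card_Ico] at h2
    exact_mod_cast h2.trans (by omega)
  have e : (1 / (n : ℝ)) * ∑ i ∈ Finset.range n, a i - b =
      (∑ i ∈ Finset.range n, (a i - b)) / n := by
    rw [Finset.sum_sub_distrib, Finset.sum_const, Finset.card_range, nsmul_eq_mul]
    field_simp
  rw [e, abs_div, abs_of_pos hn0]
  refine div_le_div_of_nonneg_right ?_ hn0.le
  exact (Finset.abs_sum_le_sum_abs _ _).trans ((Finset.sum_le_sum fun i _ => hle i).trans hcard)

lemma FCtx.avg_ent (c : FCtx X Y σX σY π τ f M) (ν : Measure Y) [IsProbabilityMeasure ν]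
    (hν : MeasurePreserving σY ν ν) (n : ℕ) (hn : 1 ≤ n) (lam : Measure X)
    [IsProbabilityMeasure lam]
    (hlam : ent lam (wd X n) + ∫ x, birk σX f n x ∂lam =
        ent ν (wd Y n) + ∫ y, Real.log (Rsup σX f n (fibM π n y)) ∂ν) (q : ℕ) (hq : 1 ≤ q) :
    ent ν (wd Y n) / n + ∫ y, Ufun σX π f y ∂ν ≤
      ent (avgM σX lam n) (wd X q) / q + q * Real.log k / n + ∫ x, f x ∂(avgM σX lam n) := by
  have hσm := (shift_cont c.hσX).measurable
  have hn0 : (0 : ℝ) < n := by exact_mod_cast hn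
  have hq0 : (0 : ℝ) < q := by exact_mod_cast hq
  rw [avgM_integral hσm lam c.hf.measurable c.hM]
  have h1 := c.Ufun_integral ν hν n hn
  have h2 := misiurewicz c.hσX lam n q
  have h3 := avgM_ent hσm lam (wd_meas (X := X) q) hn
  set H := ent (avgM σX lam n) (wd X q)
  set I := ∫ x, birk σX f n x ∂lam
  set J := ∫ y, Real.log (Rsup σX f n (fibM π n y)) ∂ν
  have h4 : ent lam (wd X n) / n ≤ H / q + q * Real.log k / n := by
    rw [div_add_div _ _ hq0.ne' hn0.ne', div_le_div_iff₀ hn0 (mul_pos hq0 hn0)]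
    have : q * ent lam (wd X n) ≤ n * H + q * (q * Real.log k) := h2.trans (by linarith)
    nlinarith [mul_le_mul_of_nonneg_left this hn0.le]
  have h5 : ent lam (wd X n) / n + 1 / n * I = ent ν (wd Y n) / n + 1 / n * J := by
    rw [one_div_mul_eq_div, one_div_mul_eq_div, ← add_div, ← add_div, hlam]
  linarith

end Lower

section Final

variable {k l : ℕ} {X : Set (ℕ → Fin k)} {Y : Set (ℕ → Fin l)} {σX : X → X} {σY : Y → Y}
    {π : X → Y} {τ : Fin k → Fin l} {f : X → ℝ} {M : ℝ}

lemma FCtx.exists_lift (c : FCtx X Y σX σY π τ f M) (ν : Measure Y) [IsProbabilityMeasure ν]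
    (hν : MeasurePreserving σY ν ν) : ∃ μ : Measure X, IsProbabilityMeasure μ ∧
      MeasurePreserving σX μ μ ∧ μ.map π = ν ∧
      mEntropy Y ν + ∫ y, Ufun σX π f y ∂ν ≤ mEntropy X μ + ∫ x, f x ∂μ := by
  have hcX : CompactSpace X := compact_X c.hX
  have hσc := shift_cont c.hσX
  have hσm := hσc.measurable
  have hπm := c.hπc.measurable
  choose lam hlamP hlam1 hlam2 using fun n : ℕ => c.exists_lam ν n
  let μs : ℕ → ProbabilityMeasure X := fun n =>
    ⟨avgM σX (lam (n + 1)) (n + 1), avgM_prob hσm (lam (n + 1)) (by omega)⟩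
  let L : Filter ℕ := (hyperfilter ℕ : Filter ℕ)
  have hL : L ≤ atTop := Nat.hyperfilter_le_atTop
  let μ : ProbabilityMeasure X := ((hyperfilter ℕ).map μs).lim
  have hlim : Tendsto μs L (𝓝 μ) := ((hyperfilter ℕ).map μs).le_nhds_lim
  have hclop : ∀ E : Set X, IsClopen E →
      Tendsto (fun n => (avgM σX (lam (n + 1)) (n + 1)).real E) L (𝓝 ((μ : Measure X).real E)) := by
    intro E hE
    have := ProbabilityMeasure.tendsto_measure_of_isClopen_of_tendsto hlim hE
    exact (NNReal.continuous_coe.tendsto _).comp this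
  have hone : ∀ C : ℝ, Tendsto (fun n : ℕ => C / ((n + 1 : ℕ) : ℝ)) L (𝓝 0) := fun C =>
    (((tendsto_const_div_atTop_nhds_zero_nat C).comp (tendsto_add_atTop_nat 1))).mono_left hL
  have hfint : Tendsto (fun n => ∫ x, f x ∂(avgM σX (lam (n + 1)) (n + 1))) L
      (𝓝 (∫ x, f x ∂(μ : Measure X))) :=
    (ProbabilityMeasure.tendsto_iff_forall_integral_tendsto.1 hlim)
      (BoundedContinuousFunction.mkOfCompact ⟨f, c.hf⟩)
  have hinv : MeasurePreserving σX (μ : Measure X) μ := by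
    refine ⟨hσm, ?_⟩
    have : IsProbabilityMeasure ((μ : Measure X).map σX) :=
      Measure.isProbabilityMeasure_map hσm.aemeasurable
    refine measure_ext_wd _ _ fun n u => ?_
    rw [map_measureReal_apply hσm (wd_meas n (measurableSet_singleton u))]
    have h1 := (hclop _ ((cyl_clopen n u).preimage hσc)).sub (hclop _ (cyl_clopen n u))
    have h2 : Tendsto (fun j => (avgM σX (lam (j + 1)) (j + 1)).real (σX ⁻¹' (wd X n ⁻¹' {u})) -
        (avgM σX (lam (j + 1)) (j + 1)).real (wd X n ⁻¹' {u})) L (𝓝 0) :=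
      squeeze_zero_norm (fun j => avgM_shift hσm (lam (j + 1)) (j + 1) _
        (wd_meas n (measurableSet_singleton u))) (hone 1)
    exact sub_eq_zero.1 (tendsto_nhds_unique h1 h2)
  have hmap : (μ : Measure X).map π = ν := by
    have : IsProbabilityMeasure ((μ : Measure X).map π) :=
      Measure.isProbabilityMeasure_map hπm.aemeasurable
    refine measure_ext_wd _ _ fun m v => ?_
    rw [map_measureReal_apply hπm (wd_meas m (measurableSet_singleton v))]
    have h1 := (hclop _ ((cyl_clopen m v).preimage c.hπc)).sub_const (ν.real (wd Y m ⁻¹' {v}))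
    have h2 : Tendsto (fun j => (avgM σX (lam (j + 1)) (j + 1)).real (π ⁻¹' (wd Y m ⁻¹' {v})) -
        ν.real (wd Y m ⁻¹' {v})) L (𝓝 0) :=
      squeeze_zero_norm (fun j => c.avg_law ν hν (j + 1) (lam (j + 1)) (hlam1 (j + 1)) m v
        (by omega)) (hone m)
    exact sub_eq_zero.1 (tendsto_nhds_unique h1 h2)
  refine ⟨μ, inferInstance, hinv, hmap, ?_⟩
  have hq : ∀ q : ℕ, 1 ≤ q → mEntropy Y ν + ∫ y, Ufun σX π f y ∂ν ≤
      ent (μ : Measure X) (wd X q) / q + ∫ x, f x ∂(μ : Measure X) := by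
    intro q hq
    have hl : Tendsto (fun n : ℕ => ent ν (wd Y (n + 1)) / ((n + 1 : ℕ) : ℝ)) L
        (𝓝 (mEntropy Y ν)) :=
      ((mEntropy_tendsto c.hσY ν hν).comp (tendsto_add_atTop_nat 1)).mono_left hL
    have hent : Tendsto (fun n => ent (avgM σX (lam (n + 1)) (n + 1)) (wd X q)) L
        (𝓝 (ent (μ : Measure X) (wd X q))) := by
      unfold ent
      refine tendsto_finsetSum _ fun u _ => ?_
      exact (Real.continuous_negMulLog.tendsto _).comp (hclop _ (cyl_clopen q u))
    have hr := ((hent.div_const (q : ℝ)).add (hone (q * Real.log k))).add hfint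
    rw [add_zero] at hr
    refine le_of_tendsto_of_tendsto (hl.add_const _) hr (Eventually.of_forall fun n => ?_)
    exact c.avg_ent ν hν (n + 1) (by omega) (lam (n + 1)) (hlam2 (n + 1)) q hq
  have hlim2 := (mEntropy_tendsto c.hσX (μ : Measure X) hinv).add_const (∫ x, f x ∂(μ : Measure X))
  refine ge_of_tendsto hlim2 ?_
  filter_upwards [eventually_ge_atTop 1] with q hq1
  exact hq q hq1

lemma FCtx.Ufun_meas : Measurable (Ufun σX π f : Y → ℝ) :=
  Measurable.limsup fun n => (Rsup_fibM_cont n n).measurable.log.const_mul _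

lemma FCtx.Lfun_meas (c : FCtx X Y σX σY π τ f M) : Measurable (Lfun σX π f : Y → ℝ) :=
  Measurable.limsup fun n => (c.Rsup_fibI_meas n).log.const_mul _

/-- The relative pressure is a.e. equal to a measurable function, and the relativised variational
principle holds. -/
lemma FCtx.relP_ae (c : FCtx X Y σX σY π τ f M) (ν : Measure Y) [IsProbabilityMeasure ν]
    (hν : MeasurePreserving σY ν ν) :
    (fun y : Y => relP X σX (fun z => (π z).1) f y.1) =ᵐ[ν] Lfun σX π f ∧
      (Lfun σX π f : Y → ℝ) =ᵐ[ν] Ufun σX π f := by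
  obtain ⟨μ, hμP, hμ, hmap, hle⟩ := c.exists_lift ν hν
  have hup := c.upper μ hμ
  rw [hmap] at hup
  have hUi : Integrable (Ufun σX π f : Y → ℝ) ν :=
    Integrable.of_bound (FCtx.Ufun_meas).aestronglyMeasurable (M + Real.log k)
      (Eventually.of_forall fun y => limsup_abs_le fun n => c.avgU n n y)
  have hLi : Integrable (Lfun σX π f : Y → ℝ) ν :=
    Integrable.of_bound c.Lfun_meas.aestronglyMeasurable (M + Real.log k)
      (Eventually.of_forall fun y => limsup_abs_le fun n => c.avgI n y)
  have hLU : ∀ y, Lfun σX π f y ≤ Ufun σX π f y := fun y => (c.le_relP y).trans (c.relP_le y)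
  have hI : ∫ y, Lfun σX π f y ∂ν = ∫ y, Ufun σX π f y ∂ν :=
    le_antisymm (integral_mono hLi hUi hLU) (by linarith)
  have hae : (Lfun σX π f : Y → ℝ) =ᵐ[ν] Ufun σX π f :=
    (integral_eq_iff_of_ae_le hLi hUi (Eventually.of_forall hLU)).1 hI
  refine ⟨?_, hae⟩
  filter_upwards [hae] with y hy
  exact le_antisymm ((c.relP_le y).trans hy.symm.le) (c.le_relP y)

lemma FCtx.relP_int (c : FCtx X Y σX σY π τ f M) (μ : Measure X) [IsProbabilityMeasure μ]
    (hμ : MeasurePreserving σX μ μ) :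
    ∫ x, relP X σX (fun z => (π z).1) f (π x).1 ∂μ = ∫ y, Lfun σX π f y ∂(μ.map π) ∧
    ∫ x, relP X σX (fun z => (π z).1) f (π x).1 ∂μ = ∫ y, Ufun σX π f y ∂(μ.map π) := by
  have hπm := c.hπc.measurable
  have : IsProbabilityMeasure (μ.map π) := Measure.isProbabilityMeasure_map hπm.aemeasurable
  obtain ⟨h1, h2⟩ := c.relP_ae (μ.map π) (c.map_inv μ hμ)
  have h3 : ∫ x, relP X σX (fun z => (π z).1) f (π x).1 ∂μ =
      ∫ y, Lfun σX π f y ∂(μ.map π) := by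
    rw [integral_map hπm.aemeasurable c.Lfun_meas.aestronglyMeasurable]
    exact integral_congr_ae (ae_of_ae_map hπm.aemeasurable h1)
  exact ⟨h3, h3.trans (integral_congr_ae h2)⟩

end Final

theorem stmt10 {k l : ℕ}
    (X : Set (ℕ → Fin k)) (hX : IsSubshift X)
    (Y : Set (ℕ → Fin l)) (hY : IsSubshift Y)
    (σX : X → X) (hσX : ∀ x : X, (σX x : ℕ → Fin k) = shiftMap (x : ℕ → Fin k))
    (σY : Y → Y) (hσY : ∀ y : Y, (σY y : ℕ → Fin l) = shiftMap (y : ℕ → Fin l))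
    -- π is a one-block factor map
    (π : X → Y) (hπc : Continuous π) (hπs : Function.Surjective π)
    (hπcomm : ∀ x, π (σX x) = σY (π x))
    (hπ1 : ∃ τ : Fin k → Fin l, ∀ (x : X) (i : ℕ), (π x : ℕ → Fin l) i = τ ((x : ℕ → Fin k) i))
    (f : X → ℝ) (hf : Continuous f) :
    ∀ φ : Y → ℝ, Continuous φ →
      sSup {r : ℝ | ∃ μ : Measure X, IsProbabilityMeasure μ ∧ MeasurePreserving σX μ μ ∧
          r = mEntropy X μ
            - ∫ x, relP X σX (fun z => ((π z : ℕ → Fin l))) f ((π x : ℕ → Fin l)) ∂μ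
            + ∫ x, f x ∂μ + ∫ x, φ (π x) ∂μ} =
      sSup {r : ℝ | ∃ ν : Measure Y, IsProbabilityMeasure ν ∧ MeasurePreserving σY ν ν ∧
          r = mEntropy Y ν + ∫ y, φ y ∂ν} := by
  intro φ hφ
  obtain ⟨τ, hτ⟩ := hπ1
  have hcX : CompactSpace X := compact_X hX
  obtain ⟨M, hM⟩ : ∃ M : ℝ, ∀ x, |f x| ≤ M := by
    obtain ⟨M, hM⟩ := isCompact_univ.exists_bound_of_continuousOn hf.continuousOn
    exact ⟨M, fun x => hM x (Set.mem_univ x)⟩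
  have c : FCtx X Y σX σY π τ f M := ⟨hX, hσX, hσY, hπc, hπs, hπcomm, hτ, hf, hM⟩
  have hπm := hπc.measurable
  have hφm : ∀ μ : Measure X, ∫ x, φ (π x) ∂μ = ∫ y, φ y ∂(μ.map π) := fun μ =>
    (integral_map hπm.aemeasurable hφ.measurable.aestronglyMeasurable).symm
  refine csSup_eq_csSup_of_forall_exists_le ?_ ?_
  · rintro _ ⟨μ, hμP, hμ, rfl⟩
    have hP : IsProbabilityMeasure (μ.map π) := Measure.isProbabilityMeasure_map hπm.aemeasurable
    refine ⟨_, ⟨μ.map π, hP, c.map_inv μ hμ, rfl⟩, ?_⟩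
    rw [(c.relP_int μ hμ).1, hφm]
    have := c.upper μ hμ
    linarith
  · rintro _ ⟨ν, hνP, hν, rfl⟩
    obtain ⟨μ, hμP, hμ, hmap, hle⟩ := c.exists_lift ν hν
    refine ⟨_, ⟨μ, hμP, hμ, rfl⟩, ?_⟩
    rw [(c.relP_int μ hμ).2, hφm, hmap]
    linarith
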